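/- arXiv:1309.6401 — 2 statements merged into one kernel-verified Lean document; each statement's English description precedes it below -/
import Mathlib

section
/- Let K be a quadratic field and let c ∈ K. Suppose there exist a, b ∈ K such that both a and b are of type 1₃ for f_c(z) = z² + c, with f_c^[2](a) = f_c^[2](b) and f_c(a) ≠ f_c(b) (these conditions hold when the graph G(f_c, K) contains a graph of type 10(1,1)a). Then c = 3/16 and K = ℚ(√−7). -/
open IntermediateField

/-- The quadratic map `f_c(z) = z² + c`. -/
def fc {K : Type*} [Field K] (c : K) : K → K := fun z => z ^ 2 + c

/-- `x` is periodic of exact period `m` for `f_c`. -/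
def ExactPeriod {K : Type*} [Field K] (c : K) (m : ℕ) (x : K) : Prop :=
  (fc c)^[m] x = x ∧ ∀ k : ℕ, 1 ≤ k → k < m → (fc c)^[k] x ≠ x

/-- `x` is periodic for `f_c`. -/
def IsPeriodicPt {K : Type*} [Field K] (c : K) (x : K) : Prop :=
  ∃ m : ℕ, 1 ≤ m ∧ (fc c)^[m] x = x

/-- `x` is of type `m_n` for `f_c`: `f_c^[n] x` is periodic of exact period `m` and
`f_c^[n-1] x` is not periodic. -/
def IsTypeMN {K : Type*} [Field K] (c : K) (m n : ℕ) (x : K) : Prop :=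
  ExactPeriod c m ((fc c)^[n] x) ∧ ¬IsPeriodicPt c ((fc c)^[n - 1] x)


namespace G10

open Polynomial NumberField


noncomputable def fZ : ℤ[X] := X^3 + 4 * X^2 + 4 * X + 2

theorem fZ_natDegree : fZ.natDegree = 3 := by unfold fZ; compute_degree!
theorem fZ_monic : fZ.Monic := by unfold fZ; monicity!

theorem fZ_eis : fZ.IsEisensteinAt (Ideal.span {(2:ℤ)}) := by
  refine ⟨?_, ?_, ?_⟩
  · rw [fZ_monic.leadingCoeff]
    change (1:ℤ) ∉ Ideal.span {(2:ℤ)}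
    rw [Ideal.mem_span_singleton]; decide
  · intro n hn
    rw [fZ_natDegree] at hn
    change _ ∈ Ideal.span {(2:ℤ)}
    rw [Ideal.mem_span_singleton]
    have h2 : fZ = X^3 + C 4 * X^2 + C 4 * X + C 2 := by
      unfold fZ; simp [map_ofNat]
    rw [h2]
    interval_cases n <;> simp [coeff_X]
  · change _ ∉ (Ideal.span {(2:ℤ)})^2
    rw [Ideal.span_singleton_pow, Ideal.mem_span_singleton]
    have h2 : fZ = X^3 + C 4 * X^2 + C 4 * X + C 2 := by
      unfold fZ; simp [map_ofNat]
    rw [h2]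
    simp [coeff_X]

theorem two_prime_ideal : (Ideal.span {(2:ℤ)}).IsPrime := by
  rw [Ideal.span_singleton_prime (by norm_num)]
  exact Int.prime_two

theorem fZ_irr : Irreducible fZ :=
  fZ_eis.irreducible two_prime_ideal fZ_monic.isPrimitive (by rw [fZ_natDegree]; norm_num)

noncomputable def fQ : ℚ[X] := fZ.map (algebraMap ℤ ℚ)

theorem fQ_monic : fQ.Monic := fZ_monic.map _
theorem fQ_natDegree : fQ.natDegree = 3 := by
  unfold fQ; rw [fZ_monic.natDegree_map, fZ_natDegree]

theorem fQ_irr : Irreducible fQ :=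
  (fZ_monic.irreducible_iff_irreducible_map_fraction_map (K := ℚ)).1 fZ_irr

instance : Fact (Irreducible fQ) := ⟨fQ_irr⟩

abbrev L := AdjoinRoot fQ

instance : FiniteDimensional ℚ L := (AdjoinRoot.powerBasis fQ_irr.ne_zero).finite
instance : CharZero L := algebraRat.charZero L
instance : NumberField L := ⟨⟩

noncomputable def pb : PowerBasis ℚ L := AdjoinRoot.powerBasis fQ_irr.ne_zero
noncomputable def p : L := AdjoinRoot.root fQ
theorem pb_gen : pb.gen = p := rfl
theorem pb_dim : pb.dim = 3 := fQ_natDegree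

theorem p_rel : p^3 + 4 * p^2 + 4 * p + 2 = 0 := by
  have h := AdjoinRoot.eval₂_root fQ
  have h2 : fQ = X^3 + C 4 * X^2 + C 4 * X + C 2 := by
    unfold fQ fZ; simp [map_ofNat]
  change AdjoinRoot.root fQ ^3 + 4 * AdjoinRoot.root fQ^2 + 4 * AdjoinRoot.root fQ + 2 = 0
  rw [← AdjoinRoot.algebraMap_eq, ← aeval_def] at h
  have h3 := congrArg (aeval (AdjoinRoot.root fQ)) h2
  have h4 := h.symm.trans h3
  simpa using h4.symm

theorem aeval_p : aeval p fZ = 0 := by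
  have := p_rel
  have h2 : fZ = X^3 + C 4 * X^2 + C 4 * X + C 2 := by
    unfold fZ; simp [map_ofNat]
  rw [h2]; simpa [map_ofNat] using this

theorem p_int : IsIntegral ℤ p := ⟨fZ, fZ_monic, aeval_p⟩

theorem minpoly_p : minpoly ℤ p = fZ := by
  have h1 : minpoly ℤ p ∣ fZ := minpoly.isIntegrallyClosed_dvd p_int aeval_p
  have h2 := ((minpoly.prime_of_isIntegrallyClosed p_int).irreducible.associated_of_dvd fZ_irr h1)
  exact eq_of_monic_of_associated (minpoly.monic p_int) fZ_monic h2

theorem finrank_L : Module.finrank ℚ L = 3 := by rw [pb.finrank, pb_dim]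

noncomputable def bas : Module.Basis (Fin 3) ℚ L := pb.basis.reindex (finCongr pb_dim)

theorem bas_apply (i : Fin 3) : bas i = p ^ (i : ℕ) := by
  simp [bas, pb_gen]

theorem repr_elt (x y z : ℚ) : bas.repr ((x:L) + y * p + z * p^2) = ![x,y,z] := by
  have : ((x:L) + y * p + z * p^2) = ∑ i, (![x,y,z] i) • bas i := by
    simp [Fin.sum_univ_three, bas_apply, Algebra.smul_def]
  rw [this, Module.Basis.repr_sum_self]

theorem lmul (x y z : ℚ) : Algebra.leftMulMatrix bas ((x:L) + y * p + z * p^2) =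
    !![x, -2*z, -2*y+8*z; y, x-4*z, -4*y+14*z; z, y-4*z, x-4*y+12*z] := by
  have hp := p_rel
  ext i j
  rw [Algebra.leftMulMatrix_eq_repr_mul, bas_apply]
  have h0 : ((x:L) + y * p + z * p^2) * p^0 = ((x:ℚ):L) + y * p + z * p^2 := by ring
  have h1 : ((x:L) + y * p + z * p^2) * p^1 = ((-2*z:ℚ):L) + (x-4*z:ℚ) * p + (y-4*z:ℚ) * p^2 := by
    push_cast; linear_combination z * hp
  have h2 : ((x:L) + y * p + z * p^2) * p^2 = ((-2*y+8*z:ℚ):L) + (-4*y+14*z:ℚ) * p + (x-4*y+12*z:ℚ) * p^2 := by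
    push_cast; linear_combination (y + z * p - 4 * z) * hp
  fin_cases j
  · simp only [Fin.zero_eta]; rw [h0, repr_elt]; fin_cases i <;> rfl
  · simp only [Fin.mk_one]; rw [h1, repr_elt]; fin_cases i <;> rfl
  · simp only [Fin.reduceFinMk]; rw [h2, repr_elt]; fin_cases i <;> rfl

theorem norm_elt (x y z : ℚ) : Algebra.norm ℚ ((x:L) + y * p + z * p^2) =
    Matrix.det !![x, -2*z, -2*y+8*z; y, x-4*z, -4*y+14*z; z, y-4*z, x-4*y+12*z] := by
  rw [Algebra.norm_eq_matrix_det bas, lmul]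
theorem trace_elt (x y z : ℚ) : Algebra.trace ℚ L ((x:L) + y * p + z * p^2) =
    3 * x - 4 * y + 8 * z := by
  rw [Algebra.trace_eq_matrix_trace bas, lmul]
  simp [Matrix.trace, Fin.sum_univ_three]; ring

theorem discr_pow : Algebra.discr ℚ (fun i : Fin 3 => p ^ (i:ℕ)) = -44 := by
  have hp := p_rel
  have h0 : Algebra.trace ℚ L (1:L) = 3 := by simpa using trace_elt 1 0 0
  have h1 : Algebra.trace ℚ L p = -4 := by simpa using trace_elt 0 1 0
  have h2 : Algebra.trace ℚ L (p^2) = 8 := by simpa using trace_elt 0 0 1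
  have h3 : Algebra.trace ℚ L (p^3) = -22 := by
    have : p^3 = ((-2:ℚ):L) + (-4:ℚ) * p + (-4:ℚ) * p^2 := by push_cast; linear_combination hp
    rw [this, trace_elt]; norm_num
  have h4 : Algebra.trace ℚ L (p^4) = 64 := by
    have : p^4 = ((8:ℚ):L) + (14:ℚ) * p + (12:ℚ) * p^2 := by
      push_cast; linear_combination (p - 4) * hp
    rw [this, trace_elt]; norm_num
  rw [Algebra.discr_def, Matrix.det_fin_three]
  simp only [Algebra.traceMatrix_apply, Algebra.traceForm_apply, ← pow_add]
  simp [h0, h1, h2, h3, h4]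
  norm_num

noncomputable def pO : 𝓞 L := ⟨p, p_int⟩
theorem coe_pO : ((pO : 𝓞 L) : L) = p := rfl

theorem pO_rel : pO^3 + 4 * pO^2 + 4 * pO + 2 = 0 := by
  apply RingOfIntegers.ext
  have := p_rel
  simpa [coe_pO, map_ofNat] using this

theorem discr_powO : Algebra.discr ℤ (fun i : Fin 3 => pO ^ (i:ℕ)) = -44 := by
  have h : ((Algebra.discr ℤ (fun i : Fin 3 => pO ^ (i:ℕ)) : ℤ) : ℚ) = -44 := by
    rw [← discr_pow, Algebra.discr_def, Algebra.discr_def]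
    change (Int.castRingHom ℚ) _ = _
    rw [RingHom.map_det]
    congr 1
    ext i j
    simp only [RingHom.mapMatrix_apply, Matrix.map_apply, Algebra.traceMatrix_apply,
      Algebra.traceForm_apply, Int.coe_castRingHom]
    rw [Algebra.coe_trace_int]
    simp [coe_pO]
  exact_mod_cast h

theorem card_basis : Fintype.card (Module.Free.ChooseBasisIndex ℤ (𝓞 L)) = 3 := by
  rw [← Module.finrank_eq_card_chooseBasisIndex, RingOfIntegers.rank, finrank_L]

noncomputable def BO : Module.Basis (Fin 3) ℤ (𝓞 L) :=
  (RingOfIntegers.basis L).reindex (Fintype.equivFinOfCardEq card_basis)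

noncomputable def PM : Matrix (Fin 3) (Fin 3) ℤ := BO.toMatrix (fun i : Fin 3 => pO ^ (i:ℕ))

theorem PM_spec : (fun i : Fin 3 => pO ^ (i:ℕ)) = Matrix.vecMul BO (PM.map (algebraMap ℤ (𝓞 L))) := by
  ext1 j
  have := BO.sum_toMatrix_smul_self (fun i : Fin 3 => pO ^ (i:ℕ)) j
  rw [← this]
  simp [Matrix.vecMul, dotProduct, PM, Algebra.smul_def, mul_comm]

theorem discr_eq : PM.det ^ 2 * discr L = -44 := by
  rw [← discr_powO, PM_spec, Algebra.discr_of_matrix_vecMul, discr_eq_discr]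

theorem discr_neg : discr L < 0 := by
  have := discr_eq
  by_contra h
  push Not at h
  nlinarith [sq_nonneg PM.det, mul_nonneg (sq_nonneg PM.det) h]

theorem abs_discr_le : |discr L| ≤ 44 := by
  have h := discr_eq
  have h0 := discr_neg
  rw [abs_of_neg h0]
  have : 1 ≤ PM.det^2 := by
    by_contra h1
    have : PM.det^2 = 0 := by have := sq_nonneg PM.det; omega
    rw [this] at h; omega
  nlinarith

theorem nrc : InfinitePlace.nrComplexPlaces L = 1 ∧ InfinitePlace.nrRealPlaces L = 1 := by
  have h := InfinitePlace.card_add_two_mul_card_eq_rank L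
  rw [finrank_L] at h
  have h1 := sign_discr L
  rw [Int.sign_eq_neg_one_of_neg discr_neg] at h1
  have : InfinitePlace.nrComplexPlaces L ≠ 0 := by
    intro h2; rw [h2] at h1; simp at h1
  omega

instance : IsPrincipalIdealRing (𝓞 L) := by
  apply RingOfIntegers.isPrincipalIdealRing_of_abs_discr_lt
  rw [finrank_L, nrc.1]
  have h : ((|discr L| : ℤ) : ℝ) ≤ 44 := by exact_mod_cast abs_discr_le
  refine lt_of_le_of_lt h ?_
  have := Real.pi_gt_d2
  norm_num [Nat.factorial]
  nlinarith

theorem unit_rank : Units.rank L = 1 := by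
  unfold Units.rank
  rw [InfinitePlace.card_eq_nrRealPlaces_add_nrComplexPlaces, nrc.1, nrc.2]

theorem det_cases : PM.det = 1 ∨ PM.det = -1 ∨ PM.det = 2 ∨ PM.det = -2 := by
  have h := discr_eq
  have h0 := discr_neg
  have h3 : PM.det^2 ≤ 44 := by nlinarith [sq_nonneg PM.det]
  have h1 : PM.det ≤ 6 := by nlinarith
  have h2 : -6 ≤ PM.det := by nlinarith
  generalize PM.det = d at *
  interval_cases d <;> omega

theorem det_smul_mem (z : 𝓞 L) : ∃ a b c : ℤ, PM.det * z = a + b * pO + c * pO^2 := by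
  have hz := BO.sum_repr z
  have key : ∀ j, (PM.det : 𝓞 L) * BO j = ∑ i, ((PM.adjugate i j : ℤ) : 𝓞 L) * pO ^ (i:ℕ) := by
    intro j
    have h1 := congrArg (fun v => Matrix.vecMul v (PM.adjugate.map (algebraMap ℤ (𝓞 L)))) PM_spec
    simp only [Matrix.vecMul_vecMul, ← Matrix.map_mul, Matrix.mul_adjugate] at h1
    have h3 : ((PM.det • (1 : Matrix (Fin 3) (Fin 3) ℤ)).map (algebraMap ℤ (𝓞 L))) =
        (PM.det : 𝓞 L) • (1 : Matrix (Fin 3) (Fin 3) (𝓞 L)) := by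
      ext a b
      rw [Matrix.map_apply, Matrix.smul_apply, Matrix.smul_apply, Matrix.one_apply, Matrix.one_apply]
      split_ifs <;> simp
    rw [h3, Matrix.vecMul_smul, Matrix.vecMul_one] at h1
    have h2 := congrFun h1 j
    simp only [Pi.smul_apply, smul_eq_mul] at h2
    rw [← h2]
    simp [Matrix.vecMul, dotProduct, mul_comm]
  refine ⟨∑ j, BO.repr z j * PM.adjugate 0 j, ∑ j, BO.repr z j * PM.adjugate 1 j,
    ∑ j, BO.repr z j * PM.adjugate 2 j, ?_⟩
  simp only [Fin.sum_univ_three, zsmul_eq_mul] at key hz ⊢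
  have k0 := key 0
  have k1 := key 1
  have k2 := key 2
  simp only [Fin.val_zero, Fin.val_one, Fin.val_two, pow_zero, pow_one] at k0 k1 k2
  simp only [Int.cast_add, Int.cast_mul]
  linear_combination -(PM.det : 𝓞 L) * hz + (BO.repr z 0 : 𝓞 L) * k0 + (BO.repr z 1 : 𝓞 L) * k1 + (BO.repr z 2 : 𝓞 L) * k2

theorem mem_adj_iff (z : L) (hz : z ∈ Algebra.adjoin ℤ ({p} : Set L)) :
    ∃ a b c : ℤ, z = a + b * p + c * p^2 := by
  have hp := p_rel
  induction hz using Algebra.adjoin_induction with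
  | mem x hx => rw [Set.mem_singleton_iff] at hx; exact ⟨0, 1, 0, by rw [hx]; push_cast; ring⟩
  | algebraMap r => exact ⟨r, 0, 0, by simp⟩
  | add x y _ _ hx hy =>
    obtain ⟨a, b, c, rfl⟩ := hx
    obtain ⟨a', b', c', rfl⟩ := hy
    exact ⟨a + a', b + b', c + c', by push_cast; ring⟩
  | mul x y _ _ hx hy =>
    obtain ⟨a, b, c, rfl⟩ := hx
    obtain ⟨a', b', c', rfl⟩ := hy
    refine ⟨a * a' - 2 * (b * c' + c * b') + 8 * (c * c'),
      a * b' + b * a' - 4 * (b * c' + c * b') + 14 * (c * c'),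
      a * c' + b * b' + c * a' - 4 * (b * c' + c * b') + 12 * (c * c'), ?_⟩
    push_cast
    linear_combination ((b * c' + c * b') + (c * c') * (p - 4)) * hp

theorem elt_mem (a b c : ℤ) : ((a:L) + b * p + c * p^2) ∈ Algebra.adjoin ℤ ({p} : Set L) := by
  have h1 : p ∈ Algebra.adjoin ℤ ({p} : Set L) := Algebra.self_mem_adjoin_singleton ℤ p
  exact add_mem (add_mem (intCast_mem _ _) (mul_mem (intCast_mem _ _) h1))
    (mul_mem (intCast_mem _ _) (pow_mem h1 2))

theorem coords (z : 𝓞 L) : ∃ a b c : ℤ, z = a + b * pO + c * pO^2 := by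
  obtain ⟨a, b, c, h⟩ := det_smul_mem z
  have fin : ∀ a b c : ℤ, 2 * z = a + b * pO + c * pO^2 → ∃ a b c : ℤ, z = a + b * pO + c * pO^2 := by
    intro a b c h
    have h1 : (2:L) * (z:L) = a + b * p + c * p^2 := by
      have := congrArg (algebraMap (𝓞 L) L) h
      simpa [coe_pO, map_ofNat] using this
    have h2 : (2:ℤ) • (z:L) ∈ Algebra.adjoin ℤ ({pb.gen} : Set L) := by
      rw [zsmul_eq_mul, pb_gen]; push_cast; rw [h1]; exact elt_mem a b c
    have h3 := mem_adjoin_of_smul_prime_smul_of_minpoly_isEisensteinAt (K := ℚ) (B := pb)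
      Int.prime_two p_int z.isIntegral_coe h2 (by rw [pb_gen, minpoly_p]; exact fZ_eis)
    obtain ⟨a', b', c', h4⟩ := mem_adj_iff _ h3
    refine ⟨a', b', c', ?_⟩
    apply RingOfIntegers.ext
    simpa [coe_pO] using h4
  rcases det_cases with hd | hd | hd | hd <;> rw [hd] at h <;> push_cast at h
  · exact ⟨a, b, c, by linear_combination h⟩
  · exact ⟨-a, -b, -c, by push_cast; linear_combination -h⟩
  · exact fin a b c h
  · exact fin (-a) (-b) (-c) (by push_cast; linear_combination -h)

theorem coords_inj (a b c a' b' c' : ℤ)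
    (h : (a : 𝓞 L) + b * pO + c * pO^2 = a' + b' * pO + c' * pO^2) : a = a' ∧ b = b' ∧ c = c' := by
  have h1 : ((a:ℚ):L) + (b:ℚ) * p + (c:ℚ) * p^2 = (a':ℚ) + (b':ℚ) * p + (c':ℚ) * p^2 := by
    have := congrArg (algebraMap (𝓞 L) L) h
    simpa [coe_pO, map_ofNat] using this
  have h2 := congrArg (fun z => (bas.repr z : Fin 3 → ℚ)) h1
  simp only [repr_elt] at h2
  have e0 := congrFun h2 0
  have e1 := congrFun h2 1
  have e2 := congrFun h2 2
  simp at e0 e1 e2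
  exact ⟨e0, e1, e2⟩

noncomputable def tO : 𝓞 L := pO + 1

theorem tO_rel : tO^3 + tO^2 - tO + 1 = 0 := by
  unfold tO; linear_combination pO_rel

theorem tcoords (z : 𝓞 L) : ∃ a b c : ℤ, z = a + b * tO + c * tO^2 := by
  obtain ⟨a, b, c, rfl⟩ := coords z
  exact ⟨a - b + c, b - 2 * c, c, by unfold tO; push_cast; ring⟩

theorem tcoords_inj (a b c a' b' c' : ℤ)
    (h : (a : 𝓞 L) + b * tO + c * tO^2 = a' + b' * tO + c' * tO^2) : a = a' ∧ b = b' ∧ c = c' := by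
  have := coords_inj (a + b + c) (b + 2 * c) c (a' + b' + c') (b' + 2 * c') c' (by
    unfold tO at h; push_cast; linear_combination h)
  omega

theorem tnorm (a b c : ℤ) : Algebra.norm ℤ ((a : 𝓞 L) + b * tO + c * tO^2) =
    a^3 - b^3 + c^3 - a^2*b + 3*a^2*c - a*b^2 - a*c^2 + b^2*c + b*c^2 + 4*a*b*c := by
  have h : ((Algebra.norm ℤ ((a : 𝓞 L) + b * tO + c * tO^2) : ℤ) : ℚ) =
    a^3 - b^3 + c^3 - a^2*b + 3*a^2*c - a*b^2 - a*c^2 + b^2*c + b*c^2 + 4*a*b*c := by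
    rw [Algebra.coe_norm_int]
    have : (((a : 𝓞 L) + b * tO + c * tO^2 : 𝓞 L) : L) = ((a+b+c:ℚ):L) + (b+2*c:ℚ) * p + (c:ℚ) * p^2 := by
      unfold tO
      simp [coe_pO]; ring
    rw [this, norm_elt, Matrix.det_fin_three]
    simp
    ring
  exact_mod_cast h

theorem tO_unit : IsUnit tO := IsUnit.of_mul_eq_one (1 - tO - tO^2) (by
  linear_combination -tO_rel)

theorem tsq (a b c : ℤ) : ((a : 𝓞 L) + b * tO + c * tO^2)^2 =
    ((a^2 - 2*b*c + c^2 : ℤ) : 𝓞 L) + ((2*a*b+2*b*c-2*c^2 : ℤ) : 𝓞 L) * tO +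
      ((b^2+2*a*c-2*b*c+2*c^2 : ℤ) : 𝓞 L) * tO^2 := by
  push_cast
  linear_combination (2 * (b:𝓞 L) * c + c^2 * (tO - 1)) * tO_rel

theorem t_not_sq (v : 𝓞 L) : tO ≠ v^2 ∧ tO ≠ -v^2 := by
  obtain ⟨a, b, c, rfl⟩ := tcoords v
  rw [tsq]
  have e : tO = ((0:ℤ):𝓞 L) + ((1:ℤ):𝓞 L)*tO + ((0:ℤ):𝓞 L)*tO^2 := by
    rw [Int.cast_zero, Int.cast_one]; ring
  constructor
  · intro h
    have := (tcoords_inj 0 1 0 _ _ _ (e.symm.trans h)).2.1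
    have : 2 * (c^2 - a*b-b*c) = -1 := by linear_combination this
    omega
  · intro h
    have e2 : -((((a^2 - 2*b*c + c^2 : ℤ) : 𝓞 L)) + ((2*a*b+2*b*c-2*c^2 : ℤ) : 𝓞 L) * tO +
      ((b^2+2*a*c-2*b*c+2*c^2 : ℤ) : 𝓞 L) * tO^2) =
      ((-(a^2 - 2*b*c + c^2) : ℤ) : 𝓞 L) + ((-(2*a*b+2*b*c-2*c^2) : ℤ) : 𝓞 L) * tO +
      ((-(b^2+2*a*c-2*b*c+2*c^2) : ℤ) : 𝓞 L) * tO^2 := by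
      rw [Int.cast_neg, Int.cast_neg (2*a*b+2*b*c-2*c^2), Int.cast_neg (b^2+2*a*c-2*b*c+2*c^2)]; ring
    have := (tcoords_inj 0 1 0 _ _ _ (e.symm.trans (h.trans e2))).2.1
    have : 2 * (c^2 - a*b-b*c) = 1 := by linear_combination -this
    omega

theorem units_mod_sq (u : (𝓞 L)ˣ) : ∃ v : 𝓞 L, (u:𝓞 L) = v^2 ∨ (u:𝓞 L) = -v^2 ∨
    (u:𝓞 L) = tO * v^2 ∨ (u:𝓞 L) = -(tO * v^2) := by
  have hodd : Odd (Module.finrank ℚ L) := by rw [finrank_L]; decide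
  obtain ⟨e, he⟩ : ∃ e : (𝓞 L)ˣ, ∀ w : (𝓞 L)ˣ, ∃ k : ℤ, w = e^k ∨ w = -e^k := by
    refine ⟨Units.fundSystem L ⟨0, by rw [unit_rank]; norm_num⟩, fun w => ?_⟩
    obtain ⟨⟨x, f⟩, hxu, -⟩ := Units.exist_unique_eq_mul_prod L w
    have hprod : ∏ i, (Units.fundSystem L i) ^ (f i) =
      Units.fundSystem L ⟨0, by rw [unit_rank]; norm_num⟩ ^ f ⟨0, by rw [unit_rank]; norm_num⟩ := by
      have : Subsingleton (Fin (Units.rank L)) := by rw [unit_rank]; infer_instance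
      exact Fintype.prod_subsingleton _ _
    simp only at hxu
    rw [hprod] at hxu
    refine ⟨f ⟨0, by rw [unit_rank]; norm_num⟩, ?_⟩
    · rcases Units.torsion_eq_one_or_neg_one_of_odd_finrank hodd x with h | h
      · left; rw [hxu, h]; simp
      · right; rw [hxu, h]; simp
  obtain ⟨t, ht⟩ := tO_unit
  obtain ⟨k, hk⟩ := he t
  obtain ⟨l, hl⟩ := he u
  have hkodd : Odd k := by
    by_contra hne
    rw [Int.not_odd_iff_even] at hne
    obtain ⟨j, rfl⟩ := hne
    have h2 := t_not_sq ((e^j : (𝓞 L)ˣ) : 𝓞 L)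
    rw [← ht] at h2
    rcases hk with hk | hk
    · apply h2.1; rw [hk, zpow_add]; push_cast; ring
    · apply h2.2; rw [hk, zpow_add]; push_cast; ring
  obtain ⟨j, rfl⟩ := hkodd
  rcases Int.even_or_odd' l with ⟨i, rfl | rfl⟩
  · refine ⟨((e^i : (𝓞 L)ˣ) : 𝓞 L), ?_⟩
    rcases hl with hl | hl
    · left; rw [hl, two_mul, zpow_add]; push_cast; ring
    · right; left; rw [hl, two_mul, zpow_add]; push_cast; ring
  · have key : e^(2*i+1) = e^(2*j+1) * (e^(i-j))^2 := by
      rw [← zpow_natCast, ← zpow_mul, ← zpow_add]; congr 1; push_cast; ring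
    refine ⟨((e^(i-j) : (𝓞 L)ˣ) : 𝓞 L), ?_⟩
    rw [← ht]
    rcases hl with hl | hl <;> rcases hk with hk | hk <;> rw [hl, hk, key]
    · right; right; left; push_cast; ring
    · right; right; right; push_cast; ring
    · right; right; right; push_cast; ring
    · right; right; left; push_cast; ring

theorem eleven_not (Y d : ℤ) (hd : d ≠ 0) (h : Y^2 = 11 * d^2) : False := by
  have h1 : d^2 ∣ Y^2 := ⟨11, by rw [h]; ring⟩
  rw [Int.pow_dvd_pow_iff (by norm_num)] at h1
  obtain ⟨e, rfl⟩ := h1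
  have h2 : e^2 = 11 := by
    have : d^2 * e^2 = d^2 * 11 := by linear_combination h
    exact mul_left_cancel₀ (pow_ne_zero 2 hd) this
  have : e ≤ 3 := by nlinarith
  have : -3 ≤ e := by nlinarith
  interval_cases e <;> omega

theorem core_sq (α β γ : 𝓞 L) (Y : ℤ) (k : ℕ) (hN : Algebra.norm ℤ α = Y^2) (hY : Odd Y)
    (hab : α * β = (Y : 𝓞 L)^2) (hg : ∀ g, g ∣ α → g ∣ β → g ∣ γ)
    (hgN : Algebra.norm ℤ γ ∣ 2^k * 11) : ∃ s, α = s^2 ∨ α = -(tO * s^2) := by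
  classical
  letI : GCDMonoid (𝓞 L) := UniqueFactorizationMonoid.toGCDMonoid _
  have hY0 : Y ≠ 0 := by rintro rfl; simp at hY
  have hYO : (Y : 𝓞 L) ≠ 0 := by exact_mod_cast hY0
  obtain ⟨x, y, hx, hy, hu⟩ : ∃ x y, α = gcd α β * x ∧ β = gcd α β * y ∧ IsUnit (gcd x y) := by
    obtain ⟨x, y, h2, h3, h1⟩ := extract_gcd α β
    exact ⟨x, y, h2, h3, h1⟩
  have hga := gcd_dvd_left α β
  have hgb := gcd_dvd_right α β
  have hgg := hg _ hga hgb
  generalize gcd α β = g at *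
  have hgY : g ∣ (Y : 𝓞 L) := by
    rw [← IsIntegrallyClosed.pow_dvd_pow_iff (n := 2) (by norm_num)]
    exact ⟨x * y, by rw [← hab, hx, hy]; ring⟩
  obtain ⟨w, hw⟩ := hgY
  have hg0 : g ≠ 0 := by rintro rfl; apply hYO; rw [hw]; ring
  have hxy : x * y = w^2 := by
    have : g^2 * (x * y) = g^2 * w^2 := by
      have : g^2 * (x * y) = α * β := by rw [hx, hy]; ring
      rw [this, hab, hw]; ring
    exact mul_left_cancel₀ (pow_ne_zero 2 hg0) this
  obtain ⟨d, u, hd⟩ := exists_associated_pow_of_mul_eq_pow hu hxy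
  have hα : α = g * (u : 𝓞 L) * d^2 := by rw [hx, ← hd]; ring
  have hNu : Algebra.norm ℤ (u : 𝓞 L) = 1 ∨ Algebra.norm ℤ (u : 𝓞 L) = -1 :=
    Int.isUnit_iff.1 (u.isUnit.map (Algebra.norm ℤ))
  have hNα : Y^2 = Algebra.norm ℤ g * Algebra.norm ℤ (u : 𝓞 L) * (Algebra.norm ℤ d)^2 := by
    rw [← hN, hα]; simp
  have hNd : Algebra.norm ℤ d ≠ 0 := by
    intro h; rw [h] at hNα; apply hY0; simpa using hNα
  have hNg : Algebra.norm ℤ g ∣ 2^k * 11 := (map_dvd (Algebra.norm ℤ) hgg).trans hgN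
  have hNg2 : IsCoprime (Algebra.norm ℤ g) (2^k : ℤ) := by
    have h1 : Odd (Algebra.norm ℤ g) := by
      have h2 : Odd (Y^2) := hY.pow
      rw [hNα, mul_assoc] at h2
      exact (Int.odd_mul.1 h2).1
    apply IsCoprime.pow_right
    rw [Int.isCoprime_iff_gcd_eq_one]
    obtain ⟨j, hj⟩ := h1
    rw [← Int.isCoprime_iff_gcd_eq_one]
    exact ⟨1, -j, by rw [hj]; ring⟩
  have hNg3 : Algebra.norm ℤ g ∣ 11 := hNg2.dvd_of_dvd_mul_left hNg
  have hgu : IsUnit g := by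
    rw [isUnit_iff_norm, RingOfIntegers.coe_norm, ← Algebra.coe_norm_int]
    suffices hh : Algebra.norm ℤ g = 1 ∨ Algebra.norm ℤ g = -1 by
      rcases hh with hh | hh <;> rw [hh] <;> norm_num
    have h4 : (Algebra.norm ℤ g).natAbs ∣ 11 := by
      have := Int.natAbs_dvd_natAbs.2 hNg3; simpa using this
    rcases (Nat.dvd_prime (by norm_num)).1 h4 with h | h
    · omega
    · exfalso
      have h5 : Algebra.norm ℤ g = 11 ∨ Algebra.norm ℤ g = -11 := by omega
      have hp : 0 < Y^2 := by positivity
      have hp2 : 0 < (Algebra.norm ℤ d)^2 := by positivity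
      rcases h5 with h5 | h5 <;> rcases hNu with h6 | h6 <;> rw [h5, h6] at hNα
      · exact eleven_not Y _ hNd (by linarith)
      · linarith
      · linarith
      · exact eleven_not Y _ hNd (by linarith)
  obtain ⟨v, hv⟩ := units_mod_sq (hgu.unit * u)
  have hα2 : α = ((hgu.unit * u : (𝓞 L)ˣ) : 𝓞 L) * d^2 := by rw [hα]; simp
  have hp : 0 < Y^2 := by positivity
  have hnt : Algebra.norm ℤ tO = -1 := by
    have := tnorm 0 1 0
    simpa using this
  have hn1 : Algebra.norm ℤ (-1 : 𝓞 L) = -1 := by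
    have := tnorm (-1) 0 0
    simpa using this
  refine ⟨v * d, ?_⟩
  rcases hv with h | h | h | h <;> rw [h] at hα2
  · left; rw [hα2]; ring
  · exfalso
    have : α = -1 * (v*d)^2 := by rw [hα2]; ring
    rw [this, map_mul, map_pow, hn1] at hN
    nlinarith [sq_nonneg (Algebra.norm ℤ (v*d))]
  · exfalso
    have : α = tO * (v*d)^2 := by rw [hα2]; ring
    rw [this, map_mul, map_pow, hnt] at hN
    nlinarith [sq_nonneg (Algebra.norm ℤ (v*d))]
  · right; rw [hα2]; ring

theorem tmulsq (a b c : ℤ) : -(tO * ((a : 𝓞 L) + b * tO + c * tO^2)^2) =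
    ((b^2+2*a*c-2*b*c+2*c^2 : ℤ) : 𝓞 L)
    + ((-((a^2 - 2*b*c + c^2) + (b^2+2*a*c-2*b*c+2*c^2)) : ℤ) : 𝓞 L) * tO +
      (((b^2+2*a*c-2*b*c+2*c^2) - (2*a*b+2*b*c-2*c^2) : ℤ) : 𝓞 L) * tO^2 := by
  rw [tsq]
  push_cast
  linear_combination (-(b:𝓞 L)^2-2*a*c+2*b*c-2*c^2) * tO_rel

theorem sqE (m n Y : ℤ) (hmn : IsCoprime m n) (hm : Odd m)
    (h : Y^2 = m^3 + 2*m^2*n^2 - 4*m*n^4 + 8*n^6) :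
    ∃ a b c : ℤ, m = a^2 - 2*b*c + c^2 ∧ -n^2 = a*b+b*c-c^2 ∧ b^2+2*a*c-2*b*c+2*c^2 = 0 := by
  have hY : Odd Y := by
    have : Odd (Y^2) := by
      rw [h]
      have e : m^3 + 2*m^2*n^2 - 4*m*n^4 + 8*n^6 = m^3 + 2 * (m^2*n^2 - 2*m*n^4+4*n^6) := by ring
      rw [e]
      exact hm.pow.add_even (even_two_mul _)
    exact (Int.odd_pow' (by norm_num)).1 this
  obtain ⟨s, hs⟩ := core_sq ((m:ℤ) + ((-2*n^2 : ℤ):𝓞 L) * tO + ((0:ℤ):𝓞 L) * tO^2)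
    ((m:𝓞 L)^2 + m * n^2 * (2 + 2 * tO) + n^4 * (4 * tO^2 + 4 * tO - 4))
    (((-4:ℤ):𝓞 L) + ((8:ℤ):𝓞 L) * tO + ((12:ℤ):𝓞 L) * tO^2) Y 8
    (by rw [tnorm, h]; ring) hY
    (by
      have h' : (Y:𝓞 L)^2 = m^3 + 2*m^2*n^2 - 4*m*n^4 + 8*n^6 := by exact_mod_cast h
      rw [h']; push_cast
      linear_combination (-8 * (n:𝓞 L)^6) * tO_rel)
    (by
      intro g h1 h2
      obtain ⟨u, v, huv⟩ := hmn
      have huv' : (u:𝓞 L) * m + v * n = 1 := by exact_mod_cast huv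
      have hc : IsCoprime g (n:𝓞 L) := by
        obtain ⟨q, hq⟩ := h1
        refine ⟨u * q, v + 2 * u * tO * n, ?_⟩
        push_cast at hq
        linear_combination huv' - (u:𝓞 L) * hq
      refine (hc.pow_right (n := 4)).dvd_of_dvd_mul_right ?_
      have := dvd_sub h2 (h1.mul_right (m + (2 + 4 * tO) * n^2))
      convert this using 1
      push_cast; ring)
    (by rw [tnorm]; norm_num)
  obtain ⟨a, b, c, rfl⟩ := tcoords s
  rw [tmulsq, tsq] at hs
  rcases hs with hs | hs
  · obtain ⟨h1, h2, h3⟩ := tcoords_inj _ _ _ _ _ _ hs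
    refine ⟨a, b, c, h1, ?_, h3.symm⟩
    have : 2 * (-n^2) = 2 * (a*b+b*c-c^2) := by linear_combination h2
    exact mul_left_cancel₀ two_ne_zero this
  · exfalso
    obtain ⟨h1, h2, h3⟩ := tcoords_inj _ _ _ _ _ _ hs
    have : m = 2 * (a*b+b*c-c^2) := by linear_combination h1 - h3
    rw [this] at hm
    exact absurd hm (by simp)

theorem sqE2 (m n Y : ℤ) (hmn : IsCoprime m n) (hm : Odd (m - n))
    (h : Y^2 = m^3 + m^2*n^2 + 3*m*n^4 - n^6) :
    ∃ a b c : ℤ, m = a^2 - 2*b*c - c^2 ∧ -n^2 = b^2+2*a*c+2*b*c ∧ b*(a-c) = c^2 := by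
  have hY : Odd Y := by
    have : Odd (Y^2) := by
      rw [h]
      rcases Int.even_or_odd m with he | he <;> rcases Int.even_or_odd n with he2 | he2 <;>
        simp_all [parity_simps]
    exact (Int.odd_pow' (by norm_num)).1 this
  obtain ⟨s, hs⟩ := core_sq ((m:ℤ) + ((2*n^2 : ℤ):𝓞 L) * tO + ((n^2:ℤ):𝓞 L) * tO^2)
    ((m:𝓞 L)^2 + m * n^2 * (1 + (-2*tO-tO^2)) + n^4 * (3 + (-2*tO-tO^2) + (-2*tO-tO^2)^2))
    (((-6:ℤ):𝓞 L) + ((2:ℤ):𝓞 L) * tO + ((4:ℤ):𝓞 L) * tO^2) Y 4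
    (by rw [tnorm, h]; ring) hY
    (by
      have h' : (Y:𝓞 L)^2 = m^3 + m^2*n^2 + 3*m*n^4 - n^6 := by exact_mod_cast h
      rw [h']; push_cast
      linear_combination ((n:𝓞 L)^6) * (tO^3+5*tO^2+7*tO+1) * tO_rel)
    (by
      intro g h1 h2
      obtain ⟨u, v, huv⟩ := hmn
      have huv' : (u:𝓞 L) * m + v * n = 1 := by exact_mod_cast huv
      have hc : IsCoprime g (n:𝓞 L) := by
        obtain ⟨q, hq⟩ := h1
        refine ⟨u * q, v - u * n * (2 * tO + tO^2), ?_⟩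
        push_cast at hq
        linear_combination huv' - (u:𝓞 L) * hq
      refine (hc.pow_right (n := 4)).dvd_of_dvd_mul_right ?_
      have := dvd_sub h2 (h1.mul_right (m + (1 + 2 * (-2*tO-tO^2)) * n^2))
      convert this using 1
      push_cast
      linear_combination (-(n:𝓞 L)^4 * (3 * tO + 9)) * tO_rel)
    (by rw [tnorm]; norm_num)
  obtain ⟨a, b, c, rfl⟩ := tcoords s
  rw [tmulsq, tsq] at hs
  rcases hs with hs | hs
  · obtain ⟨h1, h2, h3⟩ := tcoords_inj _ _ _ _ _ _ hs
    have h2' : n^2 = a*b+b*c-c^2 := by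
      have : 2 * n^2 = 2 * (a*b+b*c-c^2) := by linear_combination h2
      exact mul_left_cancel₀ two_ne_zero this
    refine ⟨a - b + 2 * c, b - 2*c, c - b, ?_, ?_, ?_⟩
    · linear_combination h1 + 2 * (h3 - h2')
    · linear_combination h3 - 2 * h2'
    · linear_combination h3 - h2'
  · exfalso
    obtain ⟨h1, h2, h3⟩ := tcoords_inj _ _ _ _ _ _ hs
    have : m - n^2 = 2 * (a*b+b*c-c^2) := by linear_combination h1 - h3
    have h5 : Even (m - n^2) := by rw [this]; exact even_two_mul _
    have h6 : Even (m - n) := by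
      have e : m - n = (m - n^2) + n*(n-1) := by ring
      rw [e]; exact h5.add (Int.even_mul_pred_self n)
    exact absurd hm (Int.not_odd_iff_even.2 h6)

theorem rat_pt (a2 a4 a6 : ℤ) (X Y : ℚ) (h : Y^2 = X^3 + a2 * X^2 + a4 * X + a6) :
    ∃ m n W : ℤ, IsCoprime m n ∧ n ≠ 0 ∧ X * n^2 = m ∧
      W^2 = m^3 + a2 * m^2 * n^2 + a4 * m * n^4 + a6 * n^6 := by
  have hq0 : (X.den : ℚ) ≠ 0 := by exact_mod_cast X.den_nz
  have hX : X * X.den = X.num := Rat.mul_den_eq_num X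
  have hcop : IsCoprime X.num (X.den : ℤ) := by
    rw [Int.isCoprime_iff_gcd_eq_one]; exact X.reduced
  generalize hp : X.num = p at *
  have hdpos : (0:ℤ) < X.den := by exact_mod_cast X.den_pos
  have hX' : X * ((X.den : ℤ) : ℚ) = p := by exact_mod_cast hX
  generalize (X.den : ℤ) = q at *
  have hsq : (Y * q^2)^2 = ((q * (p^3 + a2 * p^2 * q + a4 * p * q^2 + a6 * q^3) : ℤ) : ℚ) := by
    push_cast; rw [← hX', mul_pow, h]; ring
  obtain ⟨W, hW⟩ : ∃ W : ℤ, Y * q^2 = W := by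
    have hint : IsIntegral ℤ (Y * (q:ℚ)^2) := by
      apply IsIntegral.of_pow (n := 2) (by norm_num)
      rw [hsq]
      exact isIntegral_algebraMap
    obtain ⟨W, hW⟩ := IsIntegrallyClosed.isIntegral_iff.1 hint
    exact ⟨W, hW.symm⟩
  rw [hW] at hsq
  have hsq' : q * (p^3 + a2 * p^2 * q + a4 * p * q^2 + a6 * q^3) = W^2 := by exact_mod_cast hsq.symm
  have hc2 : IsCoprime q (p^3 + a2 * p^2 * q + a4 * p * q^2 + a6 * q^3) := by
    have h1 : IsCoprime q (p^3) := hcop.symm.pow_right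
    have h2 := h1.add_mul_left_right (a2 * p^2 + a4 * p * q + a6 * q^2)
    have e : p^3 + a2 * p^2 * q + a4 * p * q^2 + a6 * q^3
      = p^3 + q * (a2 * p^2 + a4 * p * q + a6 * q^2) := by ring
    rw [e]; exact h2
  obtain ⟨n, hn⟩ := Int.sq_of_isCoprime hc2 hsq'
  have hn' : q = n^2 := by
    rcases hn with hn | hn
    · exact hn
    · nlinarith [sq_nonneg n]
  subst hn'
  have hn0 : n ≠ 0 := by rintro rfl; norm_num at hdpos
  have hdvd : n ∣ W := by
    have : n^2 ∣ W^2 := ⟨_, hsq'.symm⟩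
    rwa [Int.pow_dvd_pow_iff (by norm_num)] at this
  obtain ⟨w, rfl⟩ := hdvd
  refine ⟨p, n, w, ?_, hn0, by rw [← hX']; push_cast; ring, ?_⟩
  · exact (IsCoprime.pow_right_iff (by norm_num)).1 hcop
  · have : n^2 * w^2 = n^2 * (p^3 + a2 * p^2 * n^2 + a4 * p * n^4 + a6 * n^6) := by
      linear_combination -hsq'
    exact mul_left_cancel₀ (pow_ne_zero 2 hn0) this

theorem dvd_step (k : ℕ) (n1 m1 v w o : ℤ) (hw : Odd w) (h : n1^2 * o = m1 * v^2 * w^2)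
    (hm1 : Odd m1) (hk : 2^k ∣ n1) : (2:ℤ)^k ∣ v := by
  have h1 : ((2:ℤ)^k)^2 ∣ m1 * w^2 * v^2 := by
    have : m1 * w^2 * v^2 = n1^2 * o := by rw [h]; ring
    rw [this]
    exact (pow_dvd_pow_of_dvd hk 2).mul_right o
  have hodd : Odd (m1 * w^2) := hm1.mul hw.pow
  have hc : IsCoprime (((2:ℤ)^k)^2) (m1 * w^2) := by
    apply IsCoprime.pow_left
    apply IsCoprime.pow_left
    obtain ⟨j, hj⟩ := hodd
    exact ⟨-j, 1, by rw [hj]; ring⟩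
  have h2 := hc.dvd_of_dvd_mul_left h1
  rwa [Int.pow_dvd_pow_iff (by norm_num)] at h2

theorem even_of_odd_mul {x y : ℤ} (hx : Odd x) (h : Even (x * y)) : Even y := by
  rcases Int.even_mul.1 h with h | h
  · exact absurd hx (Int.not_odd_iff_even.2 h)
  · exact h

theorem coprime_even {m n : ℤ} (h : IsCoprime m n) (hm : Even m) : Odd n := by
  by_contra h1
  rw [Int.not_odd_iff_even] at h1
  obtain ⟨u, v, huv⟩ := h
  obtain ⟨a, rfl⟩ := hm
  obtain ⟨b, rfl⟩ := h1
  have : 2 * (u * a + v * b) = 1 := by linear_combination huv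
  omega

theorem descE (k : ℕ) : ∀ m n Y : ℤ, IsCoprime m n → Odd m → n ≠ 0 →
    Y^2 = m^3 + 2*m^2*n^2 - 4*m*n^4 + 8*n^6 → (2:ℤ)^k ∣ n := by
  induction k with
  | zero => intros; simp
  | succ k ih =>
    intro m n Y hmn hm hn h
    obtain ⟨a, b, c, h1, h2, h3⟩ := sqE m n Y hmn hm h
    have hac : Odd (a + c) := by
      have : Odd (a^2 + c^2) := by
        have e : a^2 + c^2 = m + 2 * (b * c) := by rw [h1]; ring
        rw [e]; exact hm.add_even (even_two_mul _)
      have h5 : a^2 + c^2 = (a + c)^2 - 2 * (a * c) := by ring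
      rw [h5] at this
      by_contra h6
      rw [Int.not_odd_iff_even] at h6
      have : Even ((a + c)^2 - 2 * (a * c)) := (h6.pow_of_ne_zero (by norm_num)).sub (even_two_mul _)
      exact absurd ‹Odd ((a + c)^2 - 2 * (a * c))› (Int.not_odd_iff_even.2 this)
    have hb : Even b := by
      have : Even (b^2) := ⟨b*c-a*c-c^2, by linear_combination h3⟩
      exact (Int.even_pow' (by norm_num)).1 this
    obtain ⟨b', hb'⟩ := hb
    have hc : Even c := by
      apply even_of_odd_mul hac
      refine ⟨b'*c - b'^2, ?_⟩
      subst hb'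
      have : 2 * ((a + c) * c) = 2 * (b'*c - b'^2 + (b'*c - b'^2)) := by linear_combination h3
      exact mul_left_cancel₀ two_ne_zero this
    obtain ⟨c', hc'⟩ := hc
    have ha : Odd a := by
      subst hc'
      rcases Int.even_or_odd a with h6 | h6
      · exfalso
        exact absurd hac (Int.not_odd_iff_even.2 (h6.add ⟨c', rfl⟩))
      · exact h6
    subst hb' hc'
    have hcw : c' * (a + 2 * c' - 2 * b') = -b'^2 := by
      have : 4 * (c' * (a + 2 * c' - 2 * b')) = 4 * (-b'^2) := by linear_combination h3
      exact mul_left_cancel₀ four_ne_zero this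
    have hn2 : n^2 = 4*c'^2 - 2*b'*(a+2*c') := by linear_combination -h2
    have hne : Even n := by
      have : Even (n^2) := ⟨2*c'^2 - b'*(a+2*c'), by rw [hn2]; ring⟩
      exact (Int.even_pow' (by norm_num)).1 this
    obtain ⟨v, hv⟩ := hne
    subst hv
    have hv2 : 2 * v^2 = 2*c'^2 - b'*(a+2*c') := by
      have : 2 * (2 * v^2) = 2 * (2*c'^2 - b'*(a+2*c')) := by linear_combination hn2
      exact mul_left_cancel₀ two_ne_zero this
    have ha2 : Odd (a + 2 * c') := ha.add_even (even_two_mul _)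
    have hbe : Even b' := by
      apply even_of_odd_mul ha2
      exact ⟨c'^2 - v^2, by linear_combination hv2⟩
    have hw : Odd (a + 2 * c' - 2 * b') := ha2.sub_even (even_two_mul _)
    have hw0 : a + 2 * c' - 2 * b' ≠ 0 := by intro h0; rw [h0] at hw; simp at hw
    have hv0 : v ≠ 0 := by rintro rfl; simp at hn
    have hb0 : b' ≠ 0 := by
      rintro rfl
      have : c' = 0 := by
        have : c' * (a + 2 * c' - 2 * 0) = 0 := by rw [hcw]; ring
        exact (mul_eq_zero.1 this).resolve_right hw0
      subst this
      apply hv0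
      have : v^2 = 0 := by linarith
      simpa using this
    have hc0 : c' ≠ 0 := by
      rintro rfl
      apply hb0
      have : b'^2 = 0 := by linarith
      simpa using this
    have hc0Q : (c':ℚ) ≠ 0 := by exact_mod_cast hc0
    obtain ⟨m1, n1, W, hmn1, hn10, hX, hW⟩ := rat_pt 2 (-4) 8 (2*b'/c' - 2) (4 * v / c') (by
      have e1 : (c':ℚ) * (a + 2 * c' - 2 * b') = -b'^2 := by exact_mod_cast hcw
      have e2 : 2 * (v:ℚ)^2 = 2*c'^2 - b'*(a+2*c') := by exact_mod_cast hv2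
      field_simp
      push_cast
      linear_combination (8 * (c':ℚ)) * e2 - 8 * b' * e1)
    have hX2 : n1^2 * (2 * (b' - c')) = m1 * c' := by
      have : (n1:ℚ)^2 * (2 * (b' - c')) = m1 * c' := by
        rw [← hX]; field_simp
      exact_mod_cast this
    have hX3 : n1^2 * (2 * (a + 2*c' - 2*b' + b')) = -m1 * b' := by
      have : b' * (n1^2 * (2 * (a + 2*c' - 2*b' + b'))) = b' * (-m1 * b') := by
        linear_combination (a + 2*c' - 2*b') * hX2 + (m1 + 2 * n1^2) * hcw
      exact mul_left_cancel₀ hb0 this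
    have hX4 : n1^2 * ((a + 2*c' - 2*b' + b') * ((a + 2*c' - 2*b')^2 * (a + 2*c') - 2 * b'^3))
        = m1 * v^2 * (a + 2*c' - 2*b')^2 := by
      have : 2 * (n1^2 * ((a + 2*c' - 2*b' + b') * ((a + 2*c' - 2*b')^2 * (a + 2*c') - 2 * b'^3)))
        = 2 * (m1 * v^2 * (a + 2*c' - 2*b')^2) := by
        linear_combination ((a + 2*c' - 2*b')^2 * (a + 2*c') - 2 * b'^3) * hX3
          - m1 * (a + 2*c' - 2*b')^2 * hv2 - 2 * m1 * (c' * (a + 2*c' - 2*b') - b'^2) * hcw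
      exact mul_left_cancel₀ two_ne_zero this
    have ho : Odd ((a + 2*c' - 2*b' + b') * ((a + 2*c' - 2*b')^2 * (a + 2*c') - 2 * b'^3)) := by
      apply Odd.mul
      · exact hw.add_even hbe
      · exact (hw.pow.mul ha2).sub_even (by rw [← mul_comm]; exact (even_two.mul_left _))
    have hm1 : Odd m1 := by
      by_contra h0
      rw [Int.not_odd_iff_even] at h0
      have h1 := coprime_even hmn1 h0
      have h2 : Odd (m1 * v^2 * (a + 2*c' - 2*b')^2) := by rw [← hX4]; exact h1.pow.mul ho
      rw [mul_assoc] at h2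
      exact absurd (Int.odd_mul.1 h2).1 (Int.not_odd_iff_even.2 h0)
    have := dvd_step k n1 m1 v _ _ hw hX4 hm1 (ih m1 n1 W hmn1 hm1 hn10 (by rw [hW]; ring))
    rw [pow_succ]
    obtain ⟨j, rfl⟩ := this
    exact ⟨j, by ring⟩

theorem eq_zero_of_pow (n : ℤ) (h : ∀ k : ℕ, (2:ℤ)^k ∣ n) : n = 0 := by
  by_contra h0
  have h1 := Int.natAbs_dvd_natAbs.2 (h n.natAbs)
  rw [Int.natAbs_pow] at h1
  have h2 := Nat.le_of_dvd (Int.natAbs_pos.2 h0) h1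
  have h3 := Nat.lt_two_pow_self (n := n.natAbs)
  simp at h2
  omega

theorem noE (A D : ℤ) (Y : ℚ) (hA : Odd A) (hD : D ≠ 0)
    (h : Y^2 = (A/D:ℚ)^3 + 2 * (A/D:ℚ)^2 - 4 * (A/D:ℚ) + 8) : False := by
  obtain ⟨m, n, W, hmn, hn, hX, hW⟩ := rat_pt 2 (-4) 8 (A/D:ℚ) Y (by rw [h]; push_cast; ring)
  have hDQ : (D:ℚ) ≠ 0 := by exact_mod_cast hD
  have hX2 : A * n^2 = m * D := by
    have : (A:ℚ) * n^2 = m * D := by rw [← hX]; field_simp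
    exact_mod_cast this
  have hm : Odd m := by
    by_contra h0
    rw [Int.not_odd_iff_even] at h0
    have h1 := coprime_even hmn h0
    have h2 : Odd (m * D) := by rw [← hX2]; exact hA.mul h1.pow
    exact absurd (Int.odd_mul.1 h2).1 (Int.not_odd_iff_even.2 h0)
  exact hn (eq_zero_of_pow n fun k => descE k m n W hmn hm hn (by rw [hW]; ring))

theorem E2A (m n Y : ℤ) (hmn : IsCoprime m n) (hm : Even m)
    (h : Y^2 = m^3 + m^2*n^2 + 3*m*n^4 - n^6) : False := by
  have hn := coprime_even hmn hm
  obtain ⟨a, b, c, h1, h2, h3⟩ := sqE2 m n Y hmn (hm.sub_odd hn) h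
  have hac : Even (a - c) := by
    have : Even ((a-c)*(a+c)) := by
      have e : (a-c)*(a+c) = m + 2*(b*c) := by rw [h1]; ring
      rw [e]; exact hm.add (even_two_mul _)
    rcases Int.even_mul.1 this with h5 | h5
    · exact h5
    · have : a - c = a + c - 2 * c := by ring
      rw [this]; exact h5.sub (even_two_mul _)
  have hc : Even c := by
    have : Even (c^2) := by rw [← h3]; exact hac.mul_left b
    exact (Int.even_pow' (by norm_num)).1 this
  obtain ⟨i, hi⟩ := hac
  obtain ⟨j, rfl⟩ := hc
  have ha : a = 2 * (i + j) := by omega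
  subst ha
  have hm4 : m = 4 * ((i+j)^2 - b * j - j^2) := by rw [h1]; ring
  obtain ⟨l, rfl⟩ := hn
  generalize (i+j)^2 - b * j - j^2 = r at hm4
  subst hm4
  have h7 : Y^2 = 4 * (16*r^3 + 4*r^2*(2*l+1)^2 + 3*r*(2*l+1)^4
    - (16*l^6+48*l^5+60*l^4+40*l^3+15*l^2+3*l) -1) + 3 := by rw [h]; ring
  generalize (16*r^3 + 4*r^2*(2*l+1)^2 + 3*r*(2*l+1)^4
    - (16*l^6+48*l^5+60*l^4+40*l^3+15*l^2+3*l) -1) = s at h7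
  rcases Int.even_or_odd' Y with ⟨y, rfl | rfl⟩
  · have : 4 * (y^2 - s) = 3 := by linear_combination h7
    omega
  · have : 4 * (y^2 + y - s) = 2 := by linear_combination h7
    omega

theorem descE2 (k : ℕ) : ∀ m n Y : ℤ, IsCoprime m n → Even n → n ≠ 0 →
    Y^2 = m^3 + m^2*n^2 + 3*m*n^4 - n^6 → (2:ℤ)^k ∣ n := by
  induction k with
  | zero => intros; simp
  | succ k ih =>
    intro m n Y hmn hne hn h
    have hm : Odd m := coprime_even hmn.symm hne
    obtain ⟨a, b, c, h1, h2, h3⟩ := sqE2 m n Y hmn (hm.sub_even hne) h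
    obtain ⟨v, hv⟩ := hne
    subst hv
    have hb : Even b := by
      have : Even (b^2) := ⟨-2*v^2 - a*c-b*c, by linear_combination -h2⟩
      exact (Int.even_pow' (by norm_num)).1 this
    have hc : Even c := by
      have : Even (c^2) := by rw [← h3]; exact hb.mul_right _
      exact (Int.even_pow' (by norm_num)).1 this
    have ha : Odd a := by
      have : Odd (a^2) := by
        have e : a^2 = m + 2 * (b*c) + c^2 := by rw [h1]; ring
        rw [e]; exact (hm.add_even (even_two_mul _)).add_even (hc.pow_of_ne_zero (by norm_num))
      exact (Int.odd_pow' (by norm_num)).1 this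
    have ho : Odd (a - c) := ha.sub_even hc
    have ho0 : a - c ≠ 0 := by intro h0; rw [h0] at ho; simp at ho
    obtain ⟨c', hc'⟩ := hc
    have hv0 : v ≠ 0 := by rintro rfl; simp at hn
    have hc0 : c' ≠ 0 := by
      rintro rfl
      simp at hc'
      subst hc'
      have : b = 0 := by
        have : b * (a - 0) = 0 := by rw [h3]; ring
        exact (mul_eq_zero.1 this).resolve_right ho0
      subst this
      apply hn
      have : (v+v)^2 = 0 := by linarith
      simpa using this
    have hb0 : b ≠ 0 := by
      rintro rfl
      apply hc0
      have : c^2 = 0 := by rw [← h3]; ring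
      have : c = 0 := by simpa using this
      omega
    have hc2 : c = 2 * c' := by omega
    clear hc'
    generalize ho' : a - c = o at *
    have ha' : a = o + 2 * c' := by omega
    subst ha' hc2
    have ho1 : Odd (4*c'^3 + (o + 2*c' + b)*o^2) := by
      have e : 4*c'^3 = 2*(2*c'^3) := by ring
      rw [e]
      exact (even_two_mul _).add_odd ((ha.add_even hb).mul ho.pow)
    have hvo : -(v^2 * o^2) = c' * (4*c'^3 + (o + 2*c' + b)*o^2) := by
      have : 4 * (-(v^2 * o^2)) = 4 * (c' * (4*c'^3 + (o + 2*c' + b)*o^2)) := by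
        linear_combination o^2 * h2 + (b * o + (2*c')^2) * h3
      exact mul_left_cancel₀ four_ne_zero this
    have hbQ : (b:ℚ) ≠ 0 := by exact_mod_cast hb0
    have hcQ : (c':ℚ) ≠ 0 := by exact_mod_cast hc0
    obtain ⟨m1, n1, W, hmn1, hn10, hX, hW⟩ := rat_pt 1 3 (-1) (-4*c'/b - 1) (4 * v / b) (by
      have e1 : (b:ℚ) * o = (2*c')^2 := by exact_mod_cast h3
      have e2 : -((v:ℚ)+v)^2 = b^2 + 2 * (o + 2*c') * (2*c') + 2*b*(2*c') := by exact_mod_cast h2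
      field_simp
      push_cast
      linear_combination (-4 * (b:ℚ)) * e2 - 16 * c' * e1)
    have hX2 : n1^2 * (o + c') = -m1 * c' := by
      have h5 : (n1:ℚ)^2 * (-4*c'-b) = m1 * b := by
        rw [← hX]; field_simp
      have h6 : n1^2 * (-4*c'-b) = m1 * b := by exact_mod_cast h5
      have : 4 * c' * (n1^2 * (o + c')) = 4 * c' * (-m1 * c') := by
        linear_combination (-o) * h6 + (-n1^2-m1) * h3
      exact mul_left_cancel₀ (by simpa using hc0) this
    have hX4 : n1^2 * ((o + c') * (4*c'^3 + (o + 2*c' + b)*o^2)) = m1 * v^2 * o^2 := by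
      linear_combination (4*c'^3 + (o + 2*c' + b)*o^2) * hX2 + m1 * hvo
    have hWeq : W^2 = m1^3 + m1^2*n1^2 + 3*m1*n1^4 - n1^6 := by rw [hW]; push_cast; ring
    have hm1 : Odd m1 := by
      by_contra h0
      rw [Int.not_odd_iff_even] at h0
      exact E2A m1 n1 W hmn1 h0 hWeq
    have hve : Even v := by
      by_contra h0
      rw [Int.not_even_iff_odd] at h0
      have h5 : Odd (c' * (4*c'^3 + (o + 2*c' + b)*o^2)) := by
        rw [← hvo]; exact (h0.pow.mul ho.pow).neg
      have h6 : Odd c' := (Int.odd_mul.1 h5).1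
      have h7 : Even (-m1 * c') := by rw [← hX2]; exact (ho.add_odd h6).mul_left _
      exact absurd (hm1.neg.mul h6) (Int.not_odd_iff_even.2 h7)
    have hce : Even c' := by
      apply even_of_odd_mul ho1
      rw [mul_comm, ← hvo]
      exact ((hve.pow_of_ne_zero (by norm_num)).mul_right _).neg
    have hn1e : Even n1 := by
      have : Even (n1^2) := by
        apply even_of_odd_mul (ho.add_even hce)
        rw [mul_comm, hX2]; exact hce.mul_left _
      exact (Int.even_pow' (by norm_num)).1 this
    have := dvd_step k n1 m1 v _ _ ho hX4 hm1 (ih m1 n1 W hmn1 hn1e hn10 hWeq)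
    rw [pow_succ]
    obtain ⟨j, rfl⟩ := this
    exact ⟨j, by ring⟩

theorem noE2 (A D : ℤ) (Y : ℚ) (hA : Odd A) (hDe : Even D) (hD : D ≠ 0)
    (h : Y^2 = (A/D:ℚ)^3 + (A/D:ℚ)^2 + 3 * (A/D:ℚ) - 1) : False := by
  obtain ⟨m, n, W, hmn, hn, hX, hW⟩ := rat_pt 1 3 (-1) (A/D:ℚ) Y (by rw [h]; push_cast; ring)
  have hDQ : (D:ℚ) ≠ 0 := by exact_mod_cast hD
  have hX2 : A * n^2 = m * D := by
    have : (A:ℚ) * n^2 = m * D := by rw [← hX]; field_simp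
    exact_mod_cast this
  have hne : Even n := by
    have : Even (n^2) := by
      apply even_of_odd_mul hA; rw [hX2]; exact hDe.mul_left _
    exact (Int.even_pow' (by norm_num)).1 this
  exact hn (eq_zero_of_pow n fun k => descE2 k m n W hmn hne hn (by rw [hW]; push_cast; ring))

theorem odd_choice (V N : ℤ) (hV : Odd V) (hN : Odd N) :
    ∃ V' e : ℤ, (V' = V ∨ V' = -V) ∧ V' + N = 2 * e ∧ Odd e := by
  obtain ⟨i, rfl⟩ := hV
  obtain ⟨j, rfl⟩ := hN
  rcases Int.even_or_odd (i + j + 1) with h | h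
  · refine ⟨-(2*i+1), j - i, Or.inr rfl, by ring, ?_⟩
    obtain ⟨k, hk⟩ := h
    exact ⟨k - i - 1, by omega⟩
  · exact ⟨2*i+1, i+j+1, Or.inl rfl, by ring, h⟩

theorem ptsE (x y : ℚ) (h : y^2 = 2 * (x^3 + x^2 - x + 1)) : x = 1 ∨ x = -1 := by
  obtain ⟨m, n, W, hmn, hn, hX, hW⟩ := rat_pt 2 (-4) 8 (2*x) (2*y)
    (by push_cast; linear_combination 4 * h)
  have hW1 : W^2 = m^3 + 2*m^2*n^2 - 4*m*n^4 + 8*n^6 := by rw [hW]; ring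
  clear hW
  have hnQ : (n:ℚ) ≠ 0 := by exact_mod_cast hn
  have hme : Even m := by
    by_contra h0
    rw [Int.not_even_iff_odd] at h0
    exact hn (eq_zero_of_pow n fun k => descE k m n W hmn h0 hn hW1)
  have hno := coprime_even hmn hme
  obtain ⟨m', hm'⟩ := hme
  have hWe : Even W := by
    have : Even (W^2) := ⟨4 * (m'^3 + m'^2*n^2 - m'*n^4+n^6), by rw [hW1, hm']; ring⟩
    exact (Int.even_pow' (by norm_num)).1 this
  obtain ⟨W1, hWW⟩ := hWe
  have hW2 : W1^2 = 2 * (m'^3 + m'^2*n^2 - m'*n^4+n^6) := by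
    have : 4 * W1^2 = 4 * (2 * (m'^3 + m'^2*n^2 - m'*n^4+n^6)) := by
      rw [hWW, hm'] at hW1; linear_combination hW1
    exact mul_left_cancel₀ four_ne_zero this
  have hWe1 : Even W1 := by
    have : Even (W1^2) := by rw [hW2]; exact even_two_mul _
    exact (Int.even_pow' (by norm_num)).1 this
  obtain ⟨V, hV⟩ := hWe1
  have hW3 : 2 * V^2 = m'^3 + m'^2*n^2 - m'*n^4+n^6 := by
    have : 2 * (2 * V^2) = 2 * (m'^3 + m'^2*n^2 - m'*n^4+n^6) := by
      rw [hV] at hW2; linear_combination hW2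
    exact mul_left_cancel₀ two_ne_zero this
  have hmo : Odd m' := by
    by_contra h0
    rw [Int.not_odd_iff_even] at h0
    have h1 : Odd (m' * (m'^2 + m'*n^2 - n^4) + n^6) := (h0.mul_right _).add_odd hno.pow
    have h2 : m' * (m'^2 + m'*n^2 - n^4) + n^6 = 2 * V^2 := by rw [hW3]; ring
    rw [h2] at h1
    exact absurd h1 (Int.not_odd_iff_even.2 (even_two_mul _))
  obtain ⟨r, hr⟩ := hmo.add_odd (hno.pow (n := 2))
  have hm2 : m' = 2 * r - n^2 := by linarith
  have hV2 : V^2 = 4*r^3 - 4*r^2*n^2 + n^6 := by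
    have : 2 * V^2 = 2 * (4*r^3 - 4*r^2*n^2 + n^6) := by
      rw [hW3, hm2]; ring
    exact mul_left_cancel₀ two_ne_zero this
  have hVo : Odd V := by
    have : Odd (V^2) := by
      have e : V^2 = 2 * (2*r^3-2*r^2*n^2) + n^6 := by rw [hV2]; ring
      rw [e]; exact (even_two_mul _).add_odd hno.pow
    exact (Int.odd_pow' (by norm_num)).1 this
  obtain ⟨V', e, hV', he, heo⟩ := odd_choice V (n^3) hVo hno.pow
  have hV3 : V'^2 = 4*r^3 - 4*r^2*n^2 + n^6 := by
    rw [← hV2]; rcases hV' with rfl | rfl <;> ring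
  have hE : e^2 - e * n^3 = r^3 - r^2*n^2 := by
    have : 4 * (e^2 - e * n^3) = 4 * (r^3 - r^2*n^2) := by
      have : V' = 2 * e - n^3 := by linarith
      rw [this] at hV3; linear_combination hV3
    exact mul_left_cancel₀ four_ne_zero this
  have hEQ : (e:ℚ)^2 - e * n^3 = r^3 - r^2*n^2 := by exact_mod_cast hE
  have hxr : x * n^2 = 2 * r - n^2 := by
    have h5 : 2 * x * n^2 = ((m' + m' : ℤ) : ℚ) := by rw [hX, hm']
    rw [hm2] at h5; push_cast at h5; linarith
  clear hmn hX hW1 hm' hWW hW2 hV hW3 hV2 hV' hV3 he hmo hVo h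
  rcases Int.even_or_odd r with hre | hro
  · by_cases h0 : r = 0
    · right
      subst h0
      have : (x + 1) * n^2 = 0 := by linear_combination hxr
      have := (mul_eq_zero.1 this).resolve_right (pow_ne_zero 2 hnQ)
      linarith
    · exfalso
      obtain ⟨s, hs⟩ := hre
      have hr2 : r = 2 * s := by omega
      subst hr2
      have hs0 : s ≠ 0 := by rintro rfl; simp at h0
      have hsQ : (s:ℚ) ≠ 0 := by exact_mod_cast hs0
      push_cast at hEQ
      refine noE (e^2 + 2*n^2*s^2 - 8*s^3) ((n*s)^2)
        (4 * (2 * ((e:ℚ)/(n*(2*s)) * (((e:ℚ)/(n*(2*s)))^2 + 1 - 2*s/n^2) - 1) + 1)) ?_ ?_ ?_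
      · have e1 : e^2 + 2*n^2*s^2 - 8*s^3 = e^2 + 2 * (n^2*s^2-4*s^3) := by ring
        rw [e1]; exact heo.pow.add_even (even_two_mul _)
      · exact pow_ne_zero 2 (mul_ne_zero hn hs0)
      · have hl : ∃ l t : ℚ, l = (e:ℚ)/(n*(2*s)) ∧ t = 2*s/n^2 ∧ l^2*t - l = t^2 - t := by
          refine ⟨_, _, rfl, rfl, ?_⟩
          field_simp
          linear_combination hEQ
        obtain ⟨l, t, hl, ht, hlt⟩ := hl
        rw [← hl, ← ht]
        have hA : (((e^2 + 2*n^2*s^2 - 8*s^3 : ℤ) : ℚ) / (((n*s)^2 : ℤ) : ℚ)) =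
            4 * (l^2 + 1 - t) - 2 := by
          rw [hl, ht]; push_cast; field_simp; ring
        rw [hA]
        linear_combination (64 * (l^2+1-t)) * hlt
  · obtain ⟨s, hs⟩ := hro.sub_odd (hno.pow (n := 2))
    have hr2 : r = n^2 + 2 * s := by linarith
    subst hr2
    by_cases h0 : s = 0
    · left
      subst h0
      push_cast at hxr
      have : (x - 1) * n^2 = 0 := by linear_combination hxr
      have := (mul_eq_zero.1 this).resolve_right (pow_ne_zero 2 hnQ)
      linarith
    · exfalso
      have hsQ : (s:ℚ) ≠ 0 := by exact_mod_cast h0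
      push_cast at hEQ
      refine noE (e^2 - 4*(n^2+2*s)*s^2 - 2*n^2*s^2) ((n*s)^2)
        (4 * (2 * ((e:ℚ)/(2*n*s) * (((e:ℚ)/(2*n*s))^2 - 2*s/n^2 - 2) - 1) + 1)) ?_ ?_ ?_
      · have e1 : e^2 - 4*(n^2+2*s)*s^2 - 2*n^2*s^2 = e^2 + 2 * (-2*(n^2+2*s)*s^2-n^2*s^2) := by ring
        rw [e1]; exact heo.pow.add_even (even_two_mul _)
      · exact pow_ne_zero 2 (mul_ne_zero hn h0)
      · have hl : ∃ l t : ℚ, l = (e:ℚ)/(2*n*s) ∧ t = 2*s/n^2 ∧ l^2*t - l = (t+1)^2 := by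
          refine ⟨_, _, rfl, rfl, ?_⟩
          field_simp
          linear_combination hEQ
        obtain ⟨l, t, hl, ht, hlt⟩ := hl
        rw [← hl, ← ht]
        have hA : (((e^2 - 4*(n^2+2*s)*s^2 - 2*n^2*s^2 : ℤ) : ℚ) / (((n*s)^2 : ℤ) : ℚ)) =
            4 * (l^2 - t - 1) - 2 := by
          rw [hl, ht]; push_cast; field_simp; ring
        rw [hA]
        linear_combination (64 * (l^2-t-2)) * hlt

theorem ptsH (x w : ℚ) (h : w^2 = -x^6 + 3*x^4 + x^2 + 1) : x = 0 ∨ x = 1 ∨ x = -1 := by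
  have hX : x * x.den = x.num := Rat.mul_den_eq_num x
  have hcop : IsCoprime x.num (x.den : ℤ) := by
    rw [Int.isCoprime_iff_gcd_eq_one]; exact x.reduced
  have hn : (x.den : ℤ) ≠ 0 := by exact_mod_cast x.den_nz
  have hX' : x * ((x.den : ℤ) : ℚ) = x.num := by exact_mod_cast hX
  clear hX
  generalize hp : x.num = m at *
  generalize (x.den : ℤ) = n at *
  have hnQ : (n:ℚ) ≠ 0 := by exact_mod_cast hn
  have hsq : (w * n^3)^2 = (((n^2)^3 + (n^2)^2*m^2 + 3*n^2*m^4 - m^6 : ℤ) : ℚ) := by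
    push_cast; rw [← hX', mul_pow, h]; ring
  obtain ⟨W, hW⟩ : ∃ W : ℤ, w * n^3 = W := by
    have hint : IsIntegral ℤ (w * (n:ℚ)^3) := by
      apply IsIntegral.of_pow (n := 2) (by norm_num)
      rw [hsq]
      exact isIntegral_algebraMap
    obtain ⟨W, hW⟩ := IsIntegrallyClosed.isIntegral_iff.1 hint
    exact ⟨W, hW.symm⟩
  rw [hW] at hsq
  have hsq' : W^2 = (n^2)^3 + (n^2)^2*m^2 + 3*n^2*m^4 - m^6 := by exact_mod_cast hsq
  have hc : IsCoprime (n^2) m := hcop.symm.pow_left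
  rcases Int.even_or_odd n with hne | hno
  · exact (E2A (n^2) m W hc (hne.pow_of_ne_zero (by norm_num)) hsq').elim
  rcases Int.even_or_odd m with hme | hmo
  · left
    by_cases h0 : m = 0
    · subst h0
      have : x * (n:ℚ) = 0 := by rw [hX']; simp
      exact (mul_eq_zero.1 this).resolve_right hnQ
    · exact (h0 (eq_zero_of_pow m fun k => descE2 k (n^2) m W hc hme h0 hsq')).elim
  right
  have hm0 : m ≠ 0 := by rintro rfl; simp at hmo
  have hmQ : (m:ℚ) ≠ 0 := by exact_mod_cast hm0
  obtain ⟨d, hd⟩ : ∃ d, n^2 - m^2 = 8 * d := by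
    have h1 := Int.eight_dvd_sq_sub_one_of_odd hno
    have h2 := Int.eight_dvd_sq_sub_one_of_odd hmo
    exact ⟨(n^2 - m^2) / 8, by omega⟩
  by_cases h0 : d = 0
  · subst h0
    have h1 : (n:ℚ)^2 - m^2 = 0 := by exact_mod_cast hd
    rw [← hX'] at h1
    have h2 : (n:ℚ)^2 * ((x - 1) * (x + 1)) = 0 := by linear_combination -h1
    rcases mul_eq_zero.1 ((mul_eq_zero.1 h2).resolve_left (pow_ne_zero 2 hnQ)) with h3 | h3
    · left; linarith
    · right; linarith
  exfalso
  have hWe : Even W := by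
    have h1 : (n^2)^3 + (n^2)^2*m^2 + 3*n^2*m^4 - m^6 =
        (n^2 - m^2)^3 + 4 * n^4 * m^2 := by ring
    rw [h1, hd] at hsq'
    have : Even (W^2) := ⟨256 * d^3 + 2 * n^4*m^2, by rw [hsq']; ring⟩
    exact (Int.even_pow' (by norm_num)).1 this
  obtain ⟨V, hV⟩ := hWe
  have hV2 : V^2 = n^4*m^2 + 128 * d^3 := by
    have : 4 * V^2 = 4 * (n^4*m^2 + 128 * d^3) := by
      rw [hV] at hsq'
      have h1 : (n^2)^3 + (n^2)^2*m^2 + 3*n^2*m^4 - m^6 =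
        (n^2 - m^2)^3 + 4 * n^4 * m^2 := by ring
      rw [h1, hd] at hsq'
      linear_combination hsq'
    exact mul_left_cancel₀ four_ne_zero this
  have hVo : Odd V := by
    have : Odd (V^2) := by
      have e : V^2 = 2 * (64*d^3) + n^4*m^2 := by rw [hV2]; ring
      rw [e]; exact (even_two_mul _).add_odd (hno.pow.mul hmo.pow)
    exact (Int.odd_pow' (by norm_num)).1 this
  obtain ⟨V', e, hV', he, heo⟩ := odd_choice V (m^3) hVo hmo.pow
  have hn2 : n^2 = m^2 + 8 * d := by linarith
  have hE : e^2 - e * m^3 = 4*d*m^4+16*d^2*m^2 + 32*d^3 := by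
    have : 4 * (e^2 - e * m^3) = 4 * (4*d*m^4+16*d^2*m^2 + 32*d^3) := by
      have h1 : V'^2 = n^4*m^2 + 128 * d^3 := by
        rw [← hV2]; rcases hV' with rfl | rfl <;> ring
      have : V' = 2 * e - m^3 := by linarith
      have h2 : n^4 = (m^2 + 8 * d)^2 := by rw [← hn2]; ring
      rw [this, h2] at h1; linear_combination h1
    exact mul_left_cancel₀ four_ne_zero this
  have hEQ : (e:ℚ)^2 - e * m^3 = 4*d*m^4+16*d^2*m^2 + 32*d^3 := by exact_mod_cast hE
  have hdQ : (d:ℚ) ≠ 0 := by exact_mod_cast h0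
  refine noE2 (e^2 - 4*d^2*(m^2+8*d) - 8*m^2*d^2) ((2*m*d)^2)
    ((e:ℚ)/(2*m*d) * (((e:ℚ)/(2*m*d))^2 - 8*d/m^2 - 4) - 2) ?_ ?_ ?_ ?_
  · have e1 : e^2 - 4*d^2*(m^2+8*d) - 8*m^2*d^2 = e^2 + 2 * (-2*d^2*(m^2+8*d) - 4*m^2*d^2) := by ring
    rw [e1]; exact heo.pow.add_even (even_two_mul _)
  · exact ⟨2*m^2*d^2, by ring⟩
  · exact pow_ne_zero 2 (mul_ne_zero (mul_ne_zero two_ne_zero hm0) h0)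
  · have hl : ∃ l t : ℚ, l = (e:ℚ)/(2*m*d) ∧ t = 8*d/m^2 ∧ l^2*t - 4*l = t^2+4*t+8 := by
      refine ⟨_, _, rfl, rfl, ?_⟩
      field_simp
      linear_combination 8 * hEQ
    obtain ⟨l, t, hl, ht, hlt⟩ := hl
    rw [← hl, ← ht]
    have hA : (((e^2 - 4*d^2*(m^2+8*d) - 8*m^2*d^2 : ℤ) : ℚ) / (((2*m*d)^2 : ℤ) : ℚ)) =
        (l^2 - t - 4) + 1 := by
      rw [hl, ht]; push_cast; field_simp; ring
    rw [hA]
    linear_combination (l^2-t-4) * hlt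


theorem span2 {K : Type*} [Field K] [CharZero K] [Algebra ℚ K] (hK : Module.finrank ℚ K = 2)
    (x : K) (hx : ∀ q : ℚ, x ≠ q) (y : K) : ∃ α β : ℚ, y = α * x + β := by
  have hli : LinearIndependent ℚ ![(1:K), x] := by
    rw [LinearIndependent.pair_iff]
    intro s t hst
    simp only [Algebra.smul_def, eq_ratCast, mul_one] at hst
    by_cases ht : t = 0
    · subst ht
      simpa using hst
    · exfalso
      have htK : (t:K) ≠ 0 := by exact_mod_cast ht
      apply hx (-s/t)
      push_cast
      field_simp
      linear_combination hst
  have : FiniteDimensional ℚ K := Module.finite_of_finrank_pos (by rw [hK]; norm_num)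
  have h := hli.span_eq_top_of_card_eq_finrank' (by simp [hK])
  have hy : y ∈ Submodule.span ℚ (Set.range ![(1:K), x]) := by rw [h]; trivial
  simp only [Matrix.range_cons, Matrix.range_empty, Set.union_empty, Set.singleton_union] at hy
  rw [Submodule.mem_span_pair] at hy
  obtain ⟨a, b, hab⟩ := hy
  refine ⟨b, a, ?_⟩
  rw [← hab]
  simp only [Algebra.smul_def, eq_ratCast]
  ring

theorem indep2 {K : Type*} [Field K] [CharZero K]
    (x : K) (hx : ∀ q : ℚ, x ≠ q) (a b : ℚ) (h : (a:K) * x + b = 0) : a = 0 ∧ b = 0 := by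
  by_cases ha : a = 0
  · subst ha
    simpa using h
  · exfalso
    have htK : (a:K) ≠ 0 := by exact_mod_cast ha
    apply hx (-b/a)
    push_cast
    field_simp
    linear_combination h

theorem lineE {K : Type*} [Field K] [CharZero K] [Algebra ℚ K] (hK : Module.finrank ℚ K = 2)
    (x : K) (hx : ∀ q : ℚ, x ≠ q) (y : K) (u v : ℚ) (huv : x^2 + u * x + v = 0)
    (hy : y^2 = 2 * (x^3 + x^2 - x + 1)) :
    ∃ α : ℚ, (2*u = 4 - α^2 ∧ 2*v = α^2 - 4*α + 2) ∨ (2*u = -α^2 ∧ 2*v = -(α^2+4*α+2)) := by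
  obtain ⟨α, β, rfl⟩ := span2 hK x hx y
  obtain ⟨h1, h2⟩ := indep2 x hx (2*v - (2*u-2+α^2)*u + (2+2*α*β)) (-(2*u-2+α^2)*v - (2-β^2)) (by
    push_cast
    linear_combination hy + (2*x - (2*u-2+α^2)) * huv)
  obtain ⟨k, hk⟩ : ∃ k : ℚ, k = (2*u-2+α^2) := ⟨_, rfl⟩
  rw [← hk] at h1 h2
  have hu : 2 * u = k + 2 - α^2 := by rw [hk]; ring
  have hy0 : (α * (k/2) + β)^2 = 2 * ((k/2)^3 + (k/2)^2 - k/2 + 1) := by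
    linear_combination (k/2) * h1 + h2 + (k^2/4) * hu
  rcases ptsE _ _ hy0 with h5 | h5
  · have hk2 : k = 2 := by linarith
    subst hk2
    have h6 : (α + β - 2) * (α + β + 2) = 0 := by linear_combination hy0
    rcases mul_eq_zero.1 h6 with h7 | h7
    · have hb : β = 2 - α := by linarith
      subst hb
      exact ⟨α, Or.inl ⟨by linarith, by linear_combination -h2⟩⟩
    · have hb : β = -2 - α := by linarith
      subst hb
      exact ⟨-α, Or.inl ⟨by linear_combination hu, by linear_combination -h2⟩⟩
  · have hk2 : k = -2 := by linarith
    subst hk2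
    have h6 : (-α + β - 2) * (-α + β + 2) = 0 := by linear_combination hy0
    rcases mul_eq_zero.1 h6 with h7 | h7
    · have hb : β = 2 + α := by linarith
      subst hb
      exact ⟨α, Or.inr ⟨by linarith, by linear_combination h2⟩⟩
    · have hb : β = -2 + α := by linarith
      subst hb
      exact ⟨-α, Or.inr ⟨by linear_combination hu, by linear_combination h2⟩⟩

theorem ratcase {K : Type*} [Field K] [CharZero K] [Algebra ℚ K] (hK : Module.finrank ℚ K = 2)
    (q : ℚ) (y z : K) (h0 : q ≠ 0) (h1 : q ≠ 1) (h2 : q ≠ -1)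
    (hy : y^2 = 2 * ((q:K)^3 + q^2 - q + 1))
    (hz : z^2 = 2 * (-(q:K)^3 + q^2 + q + 1)) : False := by
  by_cases hyr : ∀ r : ℚ, y ≠ r
  · by_cases hzr : ∀ r : ℚ, z ≠ r
    · obtain ⟨α, β, rfl⟩ := span2 hK y hyr z
      obtain ⟨h5, h6⟩ := indep2 y hyr (2*α*β)
        (α^2 * (2 * (q^3 + q^2 - q + 1)) + β^2 - 2 * (-q^3 + q^2 + q + 1)) (by
          push_cast
          linear_combination hz - (α:K)^2 * hy)
      have hα : α ≠ 0 := by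
        rintro rfl
        exact hzr β (by simp)
      have hβ : β = 0 := by simpa [hα] using h5
      subst hβ
      rcases ptsH q (α * (q^3 + q^2 - q + 1)) (by
        linear_combination (q^3 + q^2 - q + 1)/2 * h6) with h | h | h
      · exact h0 h
      · exact h1 h
      · exact h2 h
    · push Not at hzr
      obtain ⟨r, rfl⟩ := hzr
      rcases ptsE (-q) r (by
        have : r^2 = 2 * (-q^3 + q^2 + q + 1) := by exact_mod_cast hz
        rw [this]; ring) with h | h
      · exact h2 (by linarith)
      · exact h1 (by linarith)
  · push Not at hyr
    obtain ⟨r, rfl⟩ := hyr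
    rcases ptsE q r (by exact_mod_cast hy) with h | h
    · exact h1 h
    · exact h2 h

theorem quad {K : Type*} [Field K] [CharZero K] [Algebra ℚ K] (hK : Module.finrank ℚ K = 2)
    (x y z : K) (h0 : x ≠ 0) (h1 : x^2 ≠ 1)
    (hy : y^2 = 2 * (x^3 + x^2 - x + 1))
    (hz : z^2 = 2 * (-x^3 + x^2 + x + 1)) : x^2 = -7 ∧ ∀ q : ℚ, x ≠ q := by
  by_cases hx : ∀ q : ℚ, x ≠ q
  · refine ⟨?_, hx⟩
    obtain ⟨u', v', huv'⟩ := span2 hK x hx (x^2)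
    obtain ⟨u, hu⟩ : ∃ u, u = -u' := ⟨_, rfl⟩
    obtain ⟨v, hv⟩ : ∃ v, v = -v' := ⟨_, rfl⟩
    have huv : x^2 + u * x + v = 0 := by rw [hu, hv, huv']; push_cast; ring
    clear huv' hu hv
    obtain ⟨α, hα⟩ := lineE hK x hx y u v huv hy
    obtain ⟨γ, hγ⟩ := lineE hK (-x) (fun q hq => hx (-q) (by push_cast; rw [← hq]; ring)) z (-u) v
      (by push_cast; linear_combination huv) (by rw [hz]; ring)
    have key : (u = 0 ∧ v = -1) → False := by
      rintro ⟨rfl, rfl⟩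
      apply h1
      push_cast at huv
      linear_combination huv
    have key2 : (u = 2 ∧ v = 1) → False := by
      rintro ⟨rfl, rfl⟩
      push_cast at huv
      have : (x + 1)^2 = 0 := by linear_combination huv
      have : x + 1 = 0 := by simpa using this
      apply hx (-1); push_cast; linear_combination this
    have key3 : (u = -2 ∧ v = 1) → False := by
      rintro ⟨rfl, rfl⟩
      push_cast at huv
      have : (x - 1)^2 = 0 := by linear_combination huv
      have : x - 1 = 0 := by simpa using this
      apply hx 1; push_cast; linear_combination this
    rcases hα with ⟨e1, e2⟩ | ⟨e1, e2⟩ <;> rcases hγ with ⟨e3, e4⟩ | ⟨e3, e4⟩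
    · have e5 : (α - γ) * (α + γ - 4) = 0 := by linear_combination e4 - e2
      have e6 : α^2 + γ^2 = 8 := by linear_combination e1 + e3
      have e7 : (α = 2) ∨ (α = -2) := by
        rcases mul_eq_zero.1 e5 with h | h
        · have : γ = α := by linarith
          subst this
          have : (γ - 2) * (γ + 2) = 0 := by linear_combination e6 / 2
          rcases mul_eq_zero.1 this with h | h
          · left; linarith
          · right; linarith
        · have : γ = 4 - α := by linarith
          subst this
          have : (α - 2)^2 = 0 := by linear_combination e6 / 2
          have : α - 2 = 0 := by simpa using this
          left; linarith
      rcases e7 with rfl | rfl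
      · exact (key ⟨by linarith, by linarith⟩).elim
      · have hu : u = 0 := by linarith
        have hv : v = 7 := by linarith
        subst hu hv
        push_cast at huv
        linear_combination huv
    · exfalso
      have e5 : γ = α - 2 := by linear_combination (-e1 - e3 - e2 + e4) / 4
      subst e5
      have : α * (α - 2) = 0 := by linear_combination (e1 + e3) / 2
      rcases mul_eq_zero.1 this with h | h
      · subst h
        exact key2 ⟨by linarith, by linarith⟩
      · have : α = 2 := by linarith
        subst this
        exact key ⟨by linarith, by linarith⟩
    · exfalso
      have e5 : γ = α + 2 := by linear_combination (e1 + e3 - e2 + e4) / 4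
      subst e5
      have : α * (α + 2) = 0 := by linear_combination (e1 + e3) / 2
      rcases mul_eq_zero.1 this with h | h
      · subst h
        exact key ⟨by linarith, by linarith⟩
      · have : α = -2 := by linarith
        subst this
        exact key3 ⟨by linarith, by linarith⟩
    · exfalso
      have e5 : α^2 + γ^2 = 0 := by linear_combination e1 + e3
      have : α = 0 := by
        have : α^2 = 0 := by nlinarith [sq_nonneg α, sq_nonneg γ]
        simpa using this
      subst this
      exact key ⟨by linarith, by linarith⟩
  · exfalso
    push Not at hx
    obtain ⟨q, rfl⟩ := hx
    refine ratcase hK q y z (by exact_mod_cast h0) ?_ ?_ hy hz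
    · rintro rfl; apply h1; norm_num
    · rintro rfl; apply h1; norm_num

end G10

/-- If `K` is a quadratic field, `c ∈ K`, and `f_c` has `K`-rational points `a, b` of type `1₃`
with `f_c²(a) = f_c²(b)` and `f_c(a) ≠ f_c(b)` (as when `G(f_c, K)` contains a graph of type
10(1,1)a), then `c = 3/16` and `K = ℚ(√-7)`. -/
theorem graph_10_1_1a_classification (K : IntermediateField ℚ ℂ)
    (hK : Module.finrank ℚ K = 2) (c a b : K)
    (ha : IsTypeMN c 1 3 a) (hb : IsTypeMN c 1 3 b)
    (heq : (fc c)^[2] a = (fc c)^[2] b) (hne : fc c a ≠ fc c b) :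
    c = 3 / 16 ∧ ∃ z : ℂ, z ^ 2 = -7 ∧ K = ℚ⟮z⟯ := by
  obtain ⟨⟨hP, -⟩, hq⟩ := ha
  have hq' : fc c (fc c (fc c a)) ≠ fc c (fc c a) := fun h => hq ⟨1, le_refl _, h⟩
  have hP' : fc c (fc c (fc c (fc c a))) = fc c (fc c (fc c a)) := hP
  have heq' : fc c (fc c a) = fc c (fc c b) := heq
  clear hP hq heq hb
  obtain ⟨p, hp⟩ : ∃ p, p = fc c a := ⟨_, rfl⟩
  obtain ⟨p', hp'⟩ : ∃ p, p = fc c b := ⟨_, rfl⟩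
  rw [← hp, ← hp'] at heq' hne
  rw [← hp] at hq' hP'
  simp only [fc] at hp hp' heq' hq' hP'
  have hpp : p' = -p := by
    have : (p - p') * (p + p') = 0 := by linear_combination heq'
    rcases mul_eq_zero.1 this with h | h
    · exact absurd (sub_eq_zero.1 h) hne
    · linear_combination h
  subst hpp
  have hp0 : p ≠ 0 := by rintro rfl; simp at hne
  obtain ⟨q, hqq⟩ : ∃ q, q = p^2 + c := ⟨_, rfl⟩
  rw [← hqq] at hq' hP'
  obtain ⟨P, hPP⟩ : ∃ P, P = q^2 + c := ⟨_, rfl⟩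
  rw [← hPP] at hq' hP'
  have hqP : q = -P := by
    have : (P - q) * (P + q) = 0 := by linear_combination hP' + hPP
    rcases mul_eq_zero.1 this with h | h
    · exact absurd (sub_eq_zero.1 h) hq'
    · linear_combination h
  subst hqP
  have hP0 : P ≠ 0 := by rintro rfl; simp at hq'
  obtain ⟨x, hx⟩ : ∃ x, x = p / P := ⟨_, rfl⟩
  have hpx : p = x * P := by rw [hx]; field_simp
  subst hpx
  have hx0 : x ≠ 0 := by rintro rfl; simp at hp0
  have hc : c = P - P^2 := by linear_combination -hPP
  have hPx : P * (1 - x^2) = 2 := by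
    have : P * (P * (1 - x^2)) = P * 2 := by linear_combination -hPP + hqq
    exact mul_left_cancel₀ hP0 this
  have hx1 : x^2 ≠ 1 := by
    intro h; rw [h] at hPx; norm_num at hPx
  have hy : (b * (1 - x^2))^2 = 2 * (x^3 + x^2 - x + 1) := by
    linear_combination (-(1-x^2)^2) * hp' - (1-x^2)^2 * hc
      + (P*(1-x^2) + 2 - (1+x)*(1-x^2)) * hPx
  have hz : (a * (1 - x^2))^2 = 2 * (-x^3 + x^2 + x + 1) := by
    linear_combination (-(1-x^2)^2) * hp - (1-x^2)^2 * hc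
      + (P*(1-x^2) + 2 - (1-x)*(1-x^2)) * hPx
  obtain ⟨h7, hxQ⟩ := G10.quad hK x _ _ hx0 hx1 hy hz
  have hP4 : P = 1/4 := by
    rw [h7] at hPx; linear_combination hPx / 8
  refine ⟨by rw [hc, hP4]; norm_num, (x:ℂ), by
    have h8 := congrArg (algebraMap K ℂ) h7
    rw [map_pow, map_neg, map_ofNat] at h8
    exact h8, ?_⟩
  apply le_antisymm
  · intro y hy
    obtain ⟨α, β, h⟩ := G10.span2 hK x hxQ ⟨y, hy⟩
    have h' : y = α * x + β := by
      have := congrArg (Subtype.val) h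
      push_cast at this
      exact this
    rw [h']
    have e1 := IntermediateField.mem_adjoin_simple_self ℚ (x:ℂ)
    have e2 : ∀ r : ℚ, (r:ℂ) ∈ ℚ⟮(x:ℂ)⟯ := fun r => by
      have := (ℚ⟮(x:ℂ)⟯).algebraMap_mem r
      simpa using this
    exact add_mem (mul_mem (e2 _) e1) (e2 _)
  · rw [IntermediateField.adjoin_simple_le_iff]
    exact x.2
end

section
/- Let K be a quadratic field and let c ∈ K. Suppose there exist p, r, s ∈ K such that p is a fixed point of f_c(z) = z² + c, both r and s are of type 2₂ for f_c, and f_c^[2](r) ≠ f_c^[2](s) (these conditions hold when the graph G(f_c, K) contains a graph of type 12(2,1,1)a). Then c = −13/16 and K = ℚ(√17). -/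
open IntermediateField

theorem hq_sq_of_coprime {a b c : ℤ} (ha : 0 < a) (h : IsCoprime a b) (heq : a * b = c ^ 2) :
    ∃ u : ℤ, a = u ^ 2 := by
  obtain ⟨u, hu | hu⟩ := Int.sq_of_gcd_eq_one (Int.isCoprime_iff_gcd_eq_one.mp h) heq
  · exact ⟨u, hu⟩
  · nlinarith [sq_nonneg u]

theorem hq_sq_or {F G W : ℤ} {p : ℕ} (hp : p.Prime) (hF : 0 < F) (hG : 0 < G)
    (hd : ∀ d : ℤ, d ∣ F → d ∣ G → d ∣ (p : ℤ)) (h : F * G = W ^ 2) :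
    ∃ U V : ℤ, (F = U ^ 2 ∧ G = V ^ 2) ∨ (F = p * U ^ 2 ∧ G = p * V ^ 2) := by
  have hp0 : (0 : ℤ) < p := by exact_mod_cast hp.pos
  have h1 : ((Int.gcd F G : ℕ) : ℤ) ∣ (p : ℤ) := hd _ (Int.gcd_dvd_left ..) (Int.gcd_dvd_right ..)
  rcases (Nat.dvd_prime hp).mp (Int.natCast_dvd_natCast.mp h1) with h2 | h2
  · have hc := Int.isCoprime_iff_gcd_eq_one.mpr h2
    obtain ⟨U, hU⟩ := hq_sq_of_coprime hF hc h
    obtain ⟨V, hV⟩ := hq_sq_of_coprime hG hc.symm (by rw [mul_comm]; exact h)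
    exact ⟨U, V, Or.inl ⟨hU, hV⟩⟩
  · obtain ⟨f, hf⟩ : (p : ℤ) ∣ F := by rw [← h2]; exact Int.gcd_dvd_left ..
    obtain ⟨g, hg⟩ : (p : ℤ) ∣ G := by rw [← h2]; exact Int.gcd_dvd_right ..
    have hf0 : 0 < f := by rw [hf] at hF; exact (mul_pos_iff_of_pos_left hp0).mp hF
    have hg0 : 0 < g := by rw [hg] at hG; exact (mul_pos_iff_of_pos_left hp0).mp hG
    have hc : IsCoprime f g := by
      rw [Int.isCoprime_iff_gcd_eq_one]
      have : Int.gcd F G = p * Int.gcd f g := by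
        rw [hf, hg, Int.gcd_mul_left]; simp
      rw [h2] at this
      exact Nat.eq_of_mul_eq_mul_left hp.pos (by omega)
    obtain ⟨w, hw⟩ : (p : ℤ) ∣ W := by
      have : (p : ℤ) ∣ W ^ 2 := by rw [← h, hf, mul_assoc]; exact dvd_mul_right _ _
      exact (Nat.prime_iff_prime_int.mp hp).dvd_of_dvd_pow this
    have h3 : f * g = w ^ 2 := by
      have : (p : ℤ) ^ 2 * (f * g) = (p : ℤ) ^ 2 * w ^ 2 := by
        rw [hf, hg, hw] at h; linear_combination h
      exact mul_left_cancel₀ (by positivity) this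
    obtain ⟨U, hU⟩ := hq_sq_of_coprime hf0 hc h3
    obtain ⟨V, hV⟩ := hq_sq_of_coprime hg0 hc.symm (by rw [mul_comm]; exact h3)
    exact ⟨U, V, Or.inr ⟨by rw [hf, hU], by rw [hg, hV]⟩⟩

theorem hq_pyth {x y z : ℤ} (h : x ^ 2 + y ^ 2 = z ^ 2) (hc : IsCoprime x y) (hx : Odd x) :
    ∃ m n : ℤ, x = m ^ 2 - n ^ 2 ∧ y = 2 * m * n ∧ |z| = m ^ 2 + n ^ 2 ∧ IsCoprime m n ∧
      (Even m ∧ Odd n ∨ Odd m ∧ Even n) ∧ 0 ≤ m := by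
  have hz : 0 < |z| := by
    apply abs_pos.mpr
    rintro rfl
    have : x = 0 := by nlinarith [sq_nonneg x, sq_nonneg y]
    rw [this] at hx; simp at hx
  obtain ⟨m, n, h1, h2, h3, h4, h5, h6⟩ := PythagoreanTriple.coprime_classification'
    (x := x) (y := y) (z := |z|)
    (by unfold PythagoreanTriple; rw [abs_mul_abs_self]; linear_combination h)
    (Int.isCoprime_iff_gcd_eq_one.mp hc) (Int.odd_iff.mp hx) hz
  exact ⟨m, n, h1, h2, h3, Int.isCoprime_iff_gcd_eq_one.mpr h4, by
    simpa only [Int.even_iff, Int.odd_iff] using h5, h6⟩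

theorem hq_four {a b c d : ℤ} (h : a * b = c * d) (ha : a ≠ 0) :
    ∃ A B C D : ℤ, c = A * B ∧ d = C * D ∧ a = A * C ∧ b = B * D := by
  obtain ⟨A, C, ⟨B, hB⟩, ⟨D, hD⟩, hA⟩ := exists_dvd_and_dvd_of_dvd_mul (Dvd.intro _ h)
  refine ⟨A, B, C, D, hB, hD, hA, mul_left_cancel₀ ha ?_⟩
  rw [h, hB, hD, hA]; ring

/-- common divisor extraction -/
theorem hq_k {n A B C D : ℤ} {N : ℕ} (hN : N.Prime) (hn : (N : ℤ) = n ^ 2 + 1)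
    (hAD : IsCoprime A D) (hBC : IsCoprime B C) (hA : A ≠ 0)
    (h : A ^ 2 * (B ^ 2 - C ^ 2) = D ^ 2 * (C ^ 2 + n ^ 2 * B ^ 2)) :
    (B ^ 2 = C ^ 2 + D ^ 2 ∧ A ^ 2 = C ^ 2 + n ^ 2 * B ^ 2) ∨
    (A ^ 2 = C ^ 2 + n ^ 2 * D ^ 2 ∧ B ^ 2 = A ^ 2 + D ^ 2) := by
  have hA2 : 0 < A ^ 2 := by positivity
  obtain ⟨k, hk⟩ : A ^ 2 ∣ C ^ 2 + n ^ 2 * B ^ 2 :=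
    (hAD.pow (m := 2) (n := 2)).dvd_of_dvd_mul_left (Dvd.intro _ h)
  have hk2 : B ^ 2 - C ^ 2 = D ^ 2 * k := by
    apply mul_left_cancel₀ hA2.ne'
    rw [h, hk]; ring
  have hN0 : (0 : ℤ) < N := by exact_mod_cast hN.pos
  have hkN : k ∣ (N : ℤ) := by
    have h1 : k ∣ (N : ℤ) * B ^ 2 := ⟨A ^ 2 + D ^ 2, by rw [hn]; linear_combination hk + hk2⟩
    have h2 : k ∣ (N : ℤ) * C ^ 2 := ⟨A ^ 2 - n ^ 2 * D ^ 2, by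
      rw [hn]; linear_combination hk - n ^ 2 * hk2⟩
    obtain ⟨u, v, huv⟩ := hBC.pow (m := 2) (n := 2)
    have := dvd_add (h1.mul_left u) (h2.mul_left v)
    rwa [show u * (N * B ^ 2) + v * (N * C ^ 2) = (N : ℤ) by linear_combination (N : ℤ) * huv] at this
  have hk0 : 0 < k := by
    have h1 : 0 ≤ A ^ 2 * k := by rw [← hk]; positivity
    have h2 : 0 ≤ k := by
      by_contra h3
      push Not at h3
      nlinarith
    rcases h2.lt_or_eq with h3 | h3
    · exact h3
    · rw [← h3] at hkN
      have := zero_dvd_iff.mp hkN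
      omega
  lift k to ℕ using hk0.le
  rcases (Nat.dvd_prime hN).mp (Int.natCast_dvd_natCast.mp hkN) with h1 | h1
  · left
    rw [h1] at hk hk2
    push_cast at hk hk2
    exact ⟨by linear_combination hk2, by linear_combination -hk⟩
  · right
    rw [h1] at hk hk2
    rw [hn] at hk hk2
    have hn1 : n ^ 2 + 1 ≠ 0 := by positivity
    constructor
    · apply mul_left_cancel₀ hn1; linear_combination -hk + n ^ 2 * hk2
    · apply mul_left_cancel₀ hn1; linear_combination hk + hk2

theorem hq_odd_sq_mod8 {a : ℤ} (h : Odd a) : a ^ 2 % 8 = 1 := by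
  obtain ⟨k, rfl⟩ := h
  obtain ⟨j, hj⟩ := Int.even_mul_succ_self k
  have : (2 * k + 1) ^ 2 = 8 * j + 1 := by linear_combination 4 * hj
  omega

theorem hq_even_sq_mod4 {a : ℤ} (h : Even a) : a ^ 2 % 4 = 0 := by
  obtain ⟨k, rfl⟩ := h
  have : (k + k) ^ 2 = 4 * k ^ 2 := by ring
  omega

/-- type II -/
theorem hq_typeII {m e N : ℤ} (hm : Odd m) (he : Odd e) (hc : IsCoprime m e)
    (h : N ^ 2 = (m * e) ^ 2 + (2 * (m ^ 2 + e ^ 2)) ^ 2) : False := by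
  have hcop : IsCoprime (m * e) (2 * (m ^ 2 + e ^ 2)) := by
    apply IsCoprime.mul_right
    · exact ((Int.isCoprime_two_left.mpr (hm.mul he))).symm
    · apply IsCoprime.mul_left
      · have : IsCoprime m (e ^ 2 + m * m) := (hc.pow_right (n := 2)).add_mul_left_right m
        convert this using 1; ring
      · have : IsCoprime e (m ^ 2 + e * e) := (hc.symm.pow_right (n := 2)).add_mul_left_right e
        convert this using 1; ring
  obtain ⟨a, b, h1, h2, h3, h4, h5, h6⟩ := hq_pyth h.symm hcop (hm.mul he)
  have hm0 : m ≠ 0 := by rintro rfl; simp at hm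
  obtain ⟨ν, σ, ρ, μ, e1, e2, e3, e4⟩ := hq_four (a := m) (b := e) (c := a + b) (d := a - b)
    (by rw [h1]; ring) hm0
  -- a+b = ν σ, a-b = ρ μ, m = ν ρ, e = σ μ
  have hab : m ^ 2 + e ^ 2 = a * b := by linarith
  have key : ν ^ 2 * (σ ^ 2 - (2 * ρ) ^ 2) = μ ^ 2 * (ρ ^ 2 + 2 ^ 2 * σ ^ 2) := by
    have : 4 * (m ^ 2 + e ^ 2) = (a + b) ^ 2 - (a - b) ^ 2 := by rw [hab]; ring
    rw [e1, e2, e3, e4] at this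
    linear_combination -this
  have hν : Odd ν := by rw [e3] at hm; exact (Int.odd_mul.mp hm).1
  have hρ : Odd ρ := by rw [e3] at hm; exact (Int.odd_mul.mp hm).2
  have hσ : Odd σ := by rw [e4] at he; exact (Int.odd_mul.mp he).1
  have hμ : Odd μ := by rw [e4] at he; exact (Int.odd_mul.mp he).2
  have hν0 : ν ≠ 0 := by rintro rfl; simp at hν
  have c1 : IsCoprime ν μ := by
    rw [e3, e4] at hc; exact hc.of_mul_left_left.of_mul_right_right
  have c2 : IsCoprime σ ρ := by
    rw [e3, e4] at hc; exact (hc.of_mul_left_right.of_mul_right_left).symm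
  obtain ⟨k, hk⟩ : ν ^ 2 ∣ ρ ^ 2 + 2 ^ 2 * σ ^ 2 :=
    (c1.pow (m := 2) (n := 2)).dvd_of_dvd_mul_left (Dvd.intro _ key)
  have hk2 : σ ^ 2 - (2 * ρ) ^ 2 = μ ^ 2 * k := by
    apply mul_left_cancel₀ (pow_ne_zero 2 hν0)
    rw [key, hk]; ring
  have hk17 : k ∣ 17 := by
    have h1 : k ∣ 17 * σ ^ 2 := ⟨4 * ν ^ 2 + μ ^ 2, by linear_combination 4 * hk + hk2⟩
    have h2 : k ∣ 17 * ρ ^ 2 := ⟨ν ^ 2 - 4 * μ ^ 2, by linear_combination hk - 4 * hk2⟩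
    obtain ⟨u, v, huv⟩ := c2.pow (m := 2) (n := 2)
    have := dvd_add (h1.mul_left u) (h2.mul_left v)
    rwa [show u * (17 * σ ^ 2) + v * (17 * ρ ^ 2) = 17 by linear_combination 17 * huv] at this
  have hk3 : k % 8 = 5 := by
    have a1 := hq_odd_sq_mod8 hσ
    have a2 := hq_odd_sq_mod8 hρ
    have a3 := hq_odd_sq_mod8 hμ
    obtain ⟨j, hj⟩ : ∃ j, μ ^ 2 = 8 * j + 1 := ⟨μ ^ 2 / 8, by omega⟩
    rw [hj] at hk2
    have : σ ^ 2 - 4 * ρ ^ 2 = 8 * (j * k) + k := by linear_combination hk2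
    omega
  have hk4 : k ≤ 17 := Int.le_of_dvd (by norm_num) hk17
  have hk5 : -k ≤ 17 := Int.le_of_dvd (by norm_num) ((neg_dvd).mpr hk17)
  obtain ⟨j, hj⟩ := hk17
  have hk6 : -17 ≤ k := by omega
  have : k = 5 ∨ k = 13 ∨ k = -3 ∨ k = -11 := by omega
  rcases this with rfl | rfl | rfl | rfl <;> omega

/-- `k = 1` is impossible for `n = 2` -/
theorem hq_k1_two {A B C D : ℤ} (hA : Odd A) (hC : Odd C)
    (h1 : B ^ 2 = C ^ 2 + D ^ 2) (h2 : A ^ 2 = C ^ 2 + 2 ^ 2 * B ^ 2) : False := by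
  have a1 := hq_odd_sq_mod8 hA
  have a2 := hq_odd_sq_mod8 hC
  rcases Int.even_or_odd B with hB | hB
  · have a3 := hq_even_sq_mod4 hB
    rcases Int.even_or_odd D with hD | hD
    · have := hq_even_sq_mod4 hD; omega
    · have := hq_odd_sq_mod8 hD; omega
  · have := hq_odd_sq_mod8 hB; omega

/-- `k = 1` is impossible for `n = 4` -/
theorem hq_k1_four {A B C D : ℤ} (hBC : IsCoprime B C) (hC : Odd C)
    (h1 : B ^ 2 = C ^ 2 + D ^ 2) (h2 : A ^ 2 = C ^ 2 + 4 ^ 2 * B ^ 2) : False := by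
  wlog hB0 : 0 ≤ B generalizing B
  · exact this (B := -B) hBC.neg_left (by linear_combination h1) (by linear_combination h2) (by omega)
  have a2 := hq_odd_sq_mod8 hC
  have hB : Odd B := by
    rcases Int.even_or_odd B with hB | hB
    · have a3 := hq_even_sq_mod4 hB
      rcases Int.even_or_odd D with hD | hD
      · have := hq_even_sq_mod4 hD; omega
      · have := hq_odd_sq_mod8 hD; omega
    · exact hB
  have a1 := hq_odd_sq_mod8 hB
  have hD : Even D := by
    rcases Int.even_or_odd D with hD | hD
    · exact hD
    · have := hq_odd_sq_mod8 hD; omega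
  have hC2 : 0 < C ^ 2 := by
    have : C ≠ 0 := by rintro rfl; simp at hC
    positivity
  have hlt : |D| < B := by
    apply lt_of_pow_lt_pow_left₀ 2 hB0
    rw [sq_abs]; omega
  have hD1 := abs_lt.mp hlt
  have hBD : IsCoprime B D := by
    have : IsCoprime B (D ^ 2) := by
      have : IsCoprime B (-C ^ 2 + B * B) := (hBC.pow_right (n := 2)).neg_right.add_mul_left_right B
      convert this using 1; linear_combination -h1
    exact (IsCoprime.pow_right_iff (by norm_num)).mp this
  have hO1 : Odd (B + D) := hB.add_even hD
  have hO2 : Odd (B - D) := hB.sub_even hD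
  have hcop : IsCoprime (B + D) (B - D) := by
    have x1 : IsCoprime (B + D) (2 * B) := by
      apply IsCoprime.mul_right
      · exact (Int.isCoprime_two_left.mpr hO1).symm
      · have := (hBD.add_mul_left_right 1).symm
        convert this using 1 <;> first | ring1 | rfl
    have := x1.neg_right.add_mul_left_right 1
    have := this.neg_right
    convert this using 1 <;> first | ring1 | rfl
  have hprod : (B + D) * (B - D) = C ^ 2 := by linear_combination h1
  obtain ⟨m, hm⟩ := hq_sq_of_coprime (by omega) hcop hprod
  obtain ⟨e, he⟩ := hq_sq_of_coprime (by omega) hcop.symm (by rw [mul_comm]; exact hprod)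
  have hOm : Odd m := by rw [hm] at hO1; exact Int.odd_pow' (by norm_num) |>.mp hO1
  have hOe : Odd e := by rw [he] at hO2; exact Int.odd_pow' (by norm_num) |>.mp hO2
  have hme : IsCoprime m e := by
    rw [hm, he] at hcop
    exact (IsCoprime.pow_iff (by norm_num) (by norm_num)).mp hcop
  apply hq_typeII (N := A) hOm hOe hme
  have : (m * e) ^ 2 = C ^ 2 := by rw [← hprod, hm, he]; ring
  rw [this, ← hm, ← he, h2]; ring

/-- the descent -/
theorem hq_descent {n : ℤ} {N : ℕ} (hN : N.Prime) (hn : (N : ℤ) = n ^ 2 + 1)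
    (hn2 : ∃ i : ℕ, n = 2 ^ (i + 1))
    (hk1 : ∀ A B C D : ℤ, Odd A → Odd C → IsCoprime B C → B ^ 2 = C ^ 2 + D ^ 2 →
      A ^ 2 = C ^ 2 + n ^ 2 * B ^ 2 → False) :
    ∀ (S : ℕ) (r s α β : ℤ), s.natAbs = S → Odd r → IsCoprime r s →
      r ^ 2 = β ^ 2 + n ^ 2 * s ^ 2 → α ^ 2 = r ^ 2 + s ^ 2 → s = 0 := by
  obtain ⟨i, hi⟩ := hn2
  have hnE : Even n := by rw [hi, pow_succ]; exact even_two.mul_left _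
  have hodd : ∀ c : ℤ, Odd c → IsCoprime n c := fun c hc => by
    rw [hi]; exact (Int.isCoprime_two_left.mpr hc).pow_left
  intro S
  induction S using Nat.strong_induction_on with
  | _ S ih =>
  intro r s α β hS hr hc h1 h2
  by_contra hs
  obtain ⟨g, h, g1, g2, g3, g4, g5, g6⟩ := hq_pyth (x := r) (y := s) (z := α) (by rw [h2]) hc hr
  have hβ : Odd β := by
    have : Odd (β ^ 2) := by
      have e1 : β ^ 2 = r ^ 2 - n ^ 2 * s ^ 2 := by rw [h1]; ring
      rw [e1]
      exact hr.pow.sub_even ((hnE.pow_of_ne_zero two_ne_zero).mul_right _)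
    exact (Int.odd_pow' (by norm_num)).mp this
  have hcβ : IsCoprime β (n * s) := by
    apply IsCoprime.mul_right
    · exact (hodd β hβ).symm
    · have : IsCoprime (β ^ 2) s := by
        have : IsCoprime (r ^ 2 + s * (- (n ^ 2 * s))) s := (hc.pow_left (m := 2)).add_mul_left_left _
        convert this using 1; linear_combination -h1
      exact (IsCoprime.pow_left_iff (by norm_num)).mp this
  obtain ⟨c, d, d1, d2, d3, d4, d5, d6⟩ := hq_pyth (x := β) (y := n * s) (z := r)
    (by rw [h1]; ring) hcβ hβ
  clear d1 d4 d6
  have hrcd : r = c ^ 2 + d ^ 2 ∨ r = -(c ^ 2 + d ^ 2) := by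
    rw [← d3]; rcases abs_choice r with h | h <;> rw [h] <;> simp
  have hcd : c * d = n * (g * h) := by rw [g2] at d2; linarith
  -- symmetrise
  have main : ∀ c d g h : ℤ, Odd c → c * d = n * (g * h) → IsCoprime g h → s = 2 * g * h →
      g ^ 2 - h ^ 2 = c ^ 2 + d ^ 2 → False := by
    intro c d g h hcO hcd hgh hsg heq
    have hc0 : c ≠ 0 := by rintro rfl; simp at hcO
    obtain ⟨d', rfl⟩ : n ∣ d := (hodd c hcO).dvd_of_dvd_mul_left ⟨_, hcd⟩
    have hn0 : n ≠ 0 := by rw [hi]; positivity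
    have hcd' : c * d' = g * h := by
      apply mul_left_cancel₀ hn0; rw [← hcd]; ring
    obtain ⟨A, B, C, D, e1, e2, e3, e4⟩ := hq_four hcd' hc0
    have hA : Odd A := by rw [e3] at hcO; exact (Int.odd_mul.mp hcO).1
    have hC : Odd C := by rw [e3] at hcO; exact (Int.odd_mul.mp hcO).2
    have hA0 : A ≠ 0 := by rintro rfl; simp at hA
    rw [e1, e2] at hgh
    have cAD : IsCoprime A D := hgh.of_mul_left_left.of_mul_right_right
    have cBC : IsCoprime B C := hgh.of_mul_left_right.of_mul_right_left
    rcases hq_k hN hn cAD cBC hA0 (by rw [e1, e2, e3, e4] at heq; linear_combination heq) with ⟨k1, k2⟩ | ⟨k1, k2⟩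
    · exact hk1 A B C D hA hC cBC k1 k2
    · have hsD : s = 2 * (A * B * C) * D := by rw [hsg, e1, e2]; ring
      have hD : D ≠ 0 := by rintro rfl; simp at hsD; exact hs hsD
      have hABC : A * B * C ≠ 0 := by intro h0; rw [h0] at hsD; simp at hsD; exact hs hsD
      have hlt : D.natAbs < S := by
        rw [← hS, hsD, Int.natAbs_mul, Int.natAbs_mul]
        have p1 : 0 < (A * B * C).natAbs := Int.natAbs_pos.mpr hABC
        have p2 : 0 < D.natAbs := Int.natAbs_pos.mpr hD
        have : (2 : ℤ).natAbs = 2 := rfl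
        rw [this]
        nlinarith
      exact hD (ih _ hlt A D B C rfl hA cAD k1 k2)
  rcases hrcd with hh | hh
  · rcases d5 with ⟨_, hd⟩ | ⟨hd, _⟩
    · exact main d c g h hd (by rw [mul_comm]; exact hcd) g4 g2 (by rw [← g1, hh]; ring)
    · exact main c d g h hd hcd g4 g2 (by rw [← g1, hh])
  · rcases d5 with ⟨_, hd⟩ | ⟨hd, _⟩
    · exact main d c h g hd (by rw [mul_comm, hcd]; ring) g4.symm (by rw [g2]; ring) (by linarith)
    · exact main c d h g hd (by rw [hcd]; ring) g4.symm (by rw [g2]; ring) (by linarith)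

theorem hq_descent_two {r s α β : ℤ} (hr : Odd r) (hc : IsCoprime r s)
    (h1 : r ^ 2 = β ^ 2 + 2 ^ 2 * s ^ 2) (h2 : α ^ 2 = r ^ 2 + s ^ 2) : s = 0 :=
  hq_descent (n := 2) (N := 5) (by norm_num) (by norm_num) ⟨0, by norm_num⟩
    (fun _ _ _ _ hA hC _ k1 k2 => hq_k1_two hA hC k1 k2) _ r s α β rfl hr hc h1 h2

theorem hq_descent_four {r s α β : ℤ} (hr : Odd r) (hc : IsCoprime r s)
    (h1 : r ^ 2 = β ^ 2 + 4 ^ 2 * s ^ 2) (h2 : α ^ 2 = r ^ 2 + s ^ 2) : s = 0 :=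
  hq_descent (n := 4) (N := 17) (by norm_num) (by norm_num) ⟨1, by norm_num⟩
    (fun _ _ _ _ _ hC c k1 k2 => hq_k1_four c hC k1 k2) _ r s α β rfl hr hc h1 h2

/-- type I -/
theorem hq_typeI {m e N : ℤ} (hm : Odd m) (hc : IsCoprime m e)
    (h : N ^ 2 = m ^ 4 + 9 * m ^ 2 * e ^ 2 + 16 * e ^ 4) : e = 0 := by
  have hx : Odd (m ^ 2 + 4 * e ^ 2) := hm.pow.add_even (by
    rw [show 4 * e ^ 2 = 2 * (2 * e ^ 2) by ring]; exact even_two_mul _)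
  have hcop : IsCoprime (m ^ 2 + 4 * e ^ 2) (m * e) := by
    apply IsCoprime.mul_right
    · have h4 : IsCoprime (4 * e ^ 2) m := by
        apply IsCoprime.mul_left
        · rw [show (4 : ℤ) = 2 ^ 2 by norm_num]; exact (Int.isCoprime_two_left.mpr hm).pow_left
        · exact hc.symm.pow_left
      have := h4.add_mul_left_left m
      convert this using 1 <;> first | ring1 | rfl
    · have := (hc.pow_left (m := 2)).add_mul_left_left (4 * e)
      convert this using 1 <;> first | ring1 | rfl
  obtain ⟨a, b, h1, h2, h3, h4, h5, h6⟩ := hq_pyth (x := m ^ 2 + 4 * e ^ 2) (y := m * e) (z := N)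
    (by rw [h]; ring) hcop hx
  have hm0 : m ≠ 0 := by rintro rfl; simp at hm
  obtain ⟨e', rfl⟩ : 2 ∣ e := (Int.isCoprime_two_left.mpr hm).dvd_of_dvd_mul_left ⟨a * b, by rw [h2]; ring⟩
  obtain ⟨p, r, q, s, e1, e2, e3, e4⟩ := hq_four (a := m) (b := e') (c := a) (d := b)
    (by linarith) hm0
  have hp : Odd p := by rw [e3] at hm; exact (Int.odd_mul.mp hm).1
  have hq : Odd q := by rw [e3] at hm; exact (Int.odd_mul.mp hm).2
  have hp0 : p ≠ 0 := by rintro rfl; simp at hp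
  rw [e1, e2] at h4
  have c1 : IsCoprime p s := h4.of_mul_left_left.of_mul_right_right
  have c2 : IsCoprime r q := h4.of_mul_left_right.of_mul_right_left
  rcases hq_k (n := 4) (N := 17) (by norm_num) (by norm_num) c1 c2 hp0
    (by rw [e1, e2, e3, e4] at h1; linear_combination -h1) with ⟨k1, k2⟩ | ⟨k1, k2⟩
  · exact (hq_k1_four c2 hq k1 k2).elim
  · have := hq_descent_four hp c1 k1 k2
    rw [e4, this]; ring

/-- rational points on `N² = X⁴ + 6X²Y² + 25Y⁴` -/
theorem hq_E1_int {X Y N : ℤ} (hc : IsCoprime X Y) (hY : Y ≠ 0)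
    (h : N ^ 2 = X ^ 4 + 6 * X ^ 2 * Y ^ 2 + 25 * Y ^ 4) : X = 0 := by
  by_contra hX
  have hY2 : 0 < Y ^ 2 := by positivity
  have hX2 : 0 < X ^ 2 := by positivity
  have hpar : Odd X ∧ Even Y ∨ Even X ∧ Odd Y := by
    rcases Int.even_or_odd X with hXe | hXo <;> rcases Int.even_or_odd Y with hYe | hYo
    · exfalso
      have := hc.isUnit_of_dvd' hXe.two_dvd hYe.two_dvd
      rw [Int.isUnit_iff] at this; omega
    · exact Or.inr ⟨hXe, hYo⟩
    · exact Or.inl ⟨hXo, hYe⟩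
    · exfalso
      have a1 := hq_odd_sq_mod8 hXo
      have a2 := hq_odd_sq_mod8 hYo
      obtain ⟨k, hk⟩ : ∃ k, X ^ 2 + 3 * Y ^ 2 = 4 * (2 * k + 1) := ⟨(X ^ 2 + 3 * Y ^ 2) / 8, by omega⟩
      have h16 : N ^ 2 = 16 * ((2 * k + 1) ^ 2 + (Y ^ 2) ^ 2) := by
        rw [h]; linear_combination (X ^ 2 + 3 * Y ^ 2 + 4 * (2 * k + 1)) * hk
      obtain ⟨M, rfl⟩ : 4 ∣ N := by
        rw [← Int.pow_dvd_pow_iff two_ne_zero]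
        exact ⟨_, h16⟩
      have hM : M ^ 2 = (2 * k + 1) ^ 2 + (Y ^ 2) ^ 2 := by linarith
      have a3 := hq_odd_sq_mod8 (odd_two_mul_add_one k)
      have a4 := hq_odd_sq_mod8 (hYo.pow (n := 2))
      rcases Int.even_or_odd M with hM1 | hM1
      · have := hq_even_sq_mod4 hM1; omega
      · have := hq_odd_sq_mod8 hM1; omega
  have hx : Odd (X ^ 2 + 3 * Y ^ 2) := by
    rcases hpar with ⟨h1, h2⟩ | ⟨h1, h2⟩
    · exact h1.pow.add_even ((h2.pow_of_ne_zero two_ne_zero).mul_left _)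
    · exact (h1.pow_of_ne_zero two_ne_zero).add_odd (Odd.mul (by decide) h2.pow)
  have hcop : IsCoprime (X ^ 2 + 3 * Y ^ 2) (4 * Y ^ 2) := by
    apply IsCoprime.mul_right
    · rw [show (4 : ℤ) = 2 ^ 2 by norm_num]; exact (Int.isCoprime_two_left.mpr hx).symm.pow_right
    · have := (hc.pow (m := 2) (n := 2)).add_mul_left_left 3
      convert this using 1 <;> first | ring1 | rfl
  obtain ⟨a, b, h1, h2, h3, h4, h5, h6⟩ := hq_pyth (z := N) (by rw [h]; ring) hcop hx
  have hab : a * b = 2 * Y ^ 2 := by linarith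
  have ha0 : 0 < a := by
    rcases h6.lt_or_eq with h | h
    · exact h
    · rw [← h] at hab; omega
  have hb0 : 0 < b := by
    have : 0 < a * b := by omega
    exact (mul_pos_iff_of_pos_left ha0).mp this
  rcases hpar with ⟨hXo, hYe⟩ | ⟨hXe, hYo⟩
  · have x1 := hq_odd_sq_mod8 hXo
    have x2 := hq_even_sq_mod4 hYe
    have haO : Odd a ∧ Even b := by
      rcases h5 with ⟨ha, hb⟩ | h5
      · have := hq_odd_sq_mod8 hb
        have := hq_even_sq_mod4 ha
        omega
      · exact h5
    obtain ⟨b', rfl⟩ := haO.2.two_dvd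
    have hab' : a * b' = Y ^ 2 := by linarith
    have h4' : IsCoprime a b' := h4.of_mul_right_right
    obtain ⟨r, hr⟩ := hq_sq_of_coprime ha0 h4' hab'
    obtain ⟨s, hs⟩ := hq_sq_of_coprime (by omega) h4'.symm (by rw [mul_comm]; exact hab')
    rw [hr, hs] at h4' hab' h1
    have hrs : IsCoprime r s := (IsCoprime.pow_iff (by norm_num) (by norm_num)).mp h4'
    have hrO : Odd r := by have := haO.1; rw [hr] at this; exact (Int.odd_pow' (by norm_num)).mp this
    have hfac : (r ^ 2 + s ^ 2) * (r ^ 2 - 4 * s ^ 2) = X ^ 2 := by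
      linear_combination -h1 - 3 * hab'
    have hr2 : 0 < r ^ 2 := by rw [← hr]; exact ha0
    have hF : 0 < r ^ 2 + s ^ 2 := by positivity
    have hG : 0 < r ^ 2 - 4 * s ^ 2 := by
      rw [← hfac] at hX2
      exact (mul_pos_iff_of_pos_left hF).mp hX2
    obtain ⟨α, β, ⟨k1, k2⟩ | ⟨k1, k2⟩⟩ := hq_sq_or (p := 5) (by norm_num) hF hG (by
      intro d d1 d2
      have e1 : d ∣ 5 * r ^ 2 := by
        have := dvd_add (d1.mul_left 4) d2
        convert this using 1 <;> first | ring1 | rfl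
      have e2 : d ∣ 5 * s ^ 2 := by
        have := dvd_sub d1 d2
        convert this using 1 <;> first | ring1 | rfl
      obtain ⟨u, v, huv⟩ := h4'
      have := dvd_add (e1.mul_left u) (e2.mul_left v)
      push_cast
      rwa [show u * (5 * r ^ 2) + v * (5 * s ^ 2) = 5 by linear_combination 5 * huv] at this) hfac
    · have := hq_descent_two (r := r) (s := s) (α := α) (β := β) hrO hrs (by linarith) k1.symm
      rw [this] at hab'
      exact hY2.ne' (by rw [← hab']; ring)
    · push_cast at k1 k2
      have y1 := hq_odd_sq_mod8 hrO
      have y2 : s ^ 2 = α ^ 2 - β ^ 2 := by linarith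
      have y3 : r ^ 2 = 4 * α ^ 2 + β ^ 2 := by linarith
      rcases Int.even_or_odd α with z1 | z1 <;> rcases Int.even_or_odd β with z2 | z2 <;>
      rcases Int.even_or_odd s with z3 | z3 <;>
      simp only [← Int.not_even_iff_odd] at * <;>
      first
      | (have w1 := hq_even_sq_mod4 z1
         first
         | (have w2 := hq_even_sq_mod4 z2; omega)
         | (have w2 := hq_odd_sq_mod8 (Int.not_even_iff_odd.mp z2)
            first
            | (have w3 := hq_even_sq_mod4 z3; omega)
            | (have w3 := hq_odd_sq_mod8 (Int.not_even_iff_odd.mp z3); omega)))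
      | (have w1 := hq_odd_sq_mod8 (Int.not_even_iff_odd.mp z1)
         first
         | (have w2 := hq_even_sq_mod4 z2; omega)
         | (have w2 := hq_odd_sq_mod8 (Int.not_even_iff_odd.mp z2); omega))
  · have x1 := hq_even_sq_mod4 hXe
    have x2 := hq_odd_sq_mod8 hYo
    have haO : Even a ∧ Odd b := by
      rcases h5 with h5 | ⟨ha, hb⟩
      · exact h5
      · have := hq_odd_sq_mod8 ha
        have := hq_even_sq_mod4 hb
        omega
    obtain ⟨a', rfl⟩ := haO.1.two_dvd
    have hab' : a' * b = Y ^ 2 := by linarith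
    have h4' : IsCoprime a' b := h4.of_mul_left_right
    obtain ⟨r, hr⟩ := hq_sq_of_coprime (by omega) h4' hab'
    obtain ⟨s, hs⟩ := hq_sq_of_coprime (by omega) h4'.symm (by rw [mul_comm]; exact hab')
    rw [hr, hs] at h4' hab' h1
    have hrs : IsCoprime r s := (IsCoprime.pow_iff (by norm_num) (by norm_num)).mp h4'
    have hYrs : Odd (r * s) := by
      have : Odd ((r * s) ^ 2) := by rw [mul_pow, hab']; exact hYo.pow
      exact (Int.odd_pow' (by norm_num)).mp this
    have hrO := hq_odd_sq_mod8 (Int.odd_mul.mp hYrs).1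
    have hsO := hq_odd_sq_mod8 (Int.odd_mul.mp hYrs).2
    have hfac : (4 * r ^ 2 + s ^ 2) * (r ^ 2 - s ^ 2) = X ^ 2 := by
      linear_combination -h1 - 3 * hab'
    have hF : 0 < 4 * r ^ 2 + s ^ 2 := by
      have := sq_nonneg r
      have := sq_nonneg s
      omega
    have hG : 0 < r ^ 2 - s ^ 2 := by
      rw [← hfac] at hX2
      exact (mul_pos_iff_of_pos_left hF).mp hX2
    obtain ⟨α, β, ⟨k1, k2⟩ | ⟨k1, k2⟩⟩ := hq_sq_or (p := 5) (by norm_num) hF hG (by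
      intro d d1 d2
      have e1 : d ∣ 5 * r ^ 2 := by
        have := dvd_add d1 d2
        convert this using 1 <;> first | ring1 | rfl
      have e2 : d ∣ 5 * s ^ 2 := by
        have := dvd_sub d1 (d2.mul_left 4)
        convert this using 1 <;> first | ring1 | rfl
      obtain ⟨u, v, huv⟩ := h4'
      have := dvd_add (e1.mul_left u) (e2.mul_left v)
      push_cast
      rwa [show u * (5 * r ^ 2) + v * (5 * s ^ 2) = 5 by linear_combination 5 * huv] at this) hfac
    · rcases Int.even_or_odd α with z1 | z1
      · have := hq_even_sq_mod4 z1; omega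
      · have := hq_odd_sq_mod8 z1; omega
    · push_cast at k1 k2
      have y2 : r ^ 2 = α ^ 2 + β ^ 2 := by linarith
      have y3 : α ^ 2 = s ^ 2 + 2 ^ 2 * β ^ 2 := by linarith
      have hαO : Odd α := by
        rcases Int.even_or_odd α with z1 | z1
        · have := hq_even_sq_mod4 z1; omega
        · exact z1
      have hcab : IsCoprime α β := by
        have : IsCoprime (α ^ 2) (β ^ 2) := by
          obtain ⟨u, v, huv⟩ := h4'
          exact ⟨u + v, u - 4 * v, by rw [← huv, y2]; linear_combination v * y3⟩
        exact (IsCoprime.pow_iff (by norm_num) (by norm_num)).mp this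
      have := hq_descent_two hαO hcab y3 y2
      rw [this] at y2 y3
      omega

theorem hq_E1 {x w : ℚ} (h : (x ^ 2 - 2 * x + 5) * (x ^ 2 + 2 * x + 5) = w ^ 2) : x = 0 := by
  have hd : (x.den : ℚ) ≠ 0 := by exact_mod_cast x.den_nz
  have hx : x = x.num / x.den := (Rat.num_div_den x).symm
  have hcop : IsCoprime x.num (x.den : ℤ) := by
    rw [Int.isCoprime_iff_gcd_eq_one]
    exact x.reduced
  have h2 : ((x.num ^ 4 + 6 * x.num ^ 2 * x.den ^ 2 + 25 * x.den ^ 4 : ℤ) : ℚ) = (w * x.den ^ 2) ^ 2 := by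
    have h3 : (w * x.den ^ 2) ^ 2 = w ^ 2 * x.den ^ 4 := by ring
    rw [h3, ← h]
    push_cast
    generalize (x.den : ℚ) = d at *
    generalize (x.num : ℚ) = n at *
    subst hx
    field_simp
    ring
  obtain ⟨N, hN⟩ : ∃ N : ℤ, N ^ 2 = x.num ^ 4 + 6 * x.num ^ 2 * x.den ^ 2 + 25 * x.den ^ 4 := by
    have : IsSquare ((x.num ^ 4 + 6 * x.num ^ 2 * x.den ^ 2 + 25 * x.den ^ 4 : ℤ) : ℚ) :=
      ⟨_, by rw [h2, sq]⟩
    rw [Rat.isSquare_intCast_iff] at this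
    obtain ⟨N, hN⟩ := this
    exact ⟨N, by rw [hN, sq]⟩
  have := hq_E1_int hcop (by exact_mod_cast x.den_nz) hN
  exact Rat.num_eq_zero.mp this

/-- positive rational points on `z² = π(4π²+9π+4)` : one parity case -/
theorem hq_cubic_even {m e Z : ℤ} (hm : 0 < m) (he : 0 < e) (hc : IsCoprime m e) (hmE : Even m)
    (h : m * e * (4 * m ^ 2 + 9 * m * e + 4 * e ^ 2) = Z ^ 2) : False := by
  have heO : Odd e := by
    rcases Int.even_or_odd e with h1 | h1
    · exfalso
      have := hc.isUnit_of_dvd' hmE.two_dvd h1.two_dvd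
      rw [Int.isUnit_iff] at this; omega
    · exact h1
  obtain ⟨m', rfl⟩ := hmE.two_dvd
  have hc' : IsCoprime m' e := hc.of_mul_left_right
  have x1 := hq_odd_sq_mod8 heO
  rcases Int.even_or_odd m' with hE | hO
  · obtain ⟨n, rfl⟩ := hE.two_dvd
    have hcn : IsCoprime n e := hc'.of_mul_left_right
    obtain ⟨W, rfl⟩ : 4 ∣ Z := by
      rw [← Int.pow_dvd_pow_iff two_ne_zero]
      exact ⟨n * e * (16 * n ^ 2 + 9 * n * e + e ^ 2), by rw [← h]; ring⟩
    have h' : n * (e * (16 * n ^ 2 + 9 * n * e + e ^ 2)) = W ^ 2 := by linarith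
    have c1 : IsCoprime n (16 * n ^ 2 + 9 * n * e + e ^ 2) := by
      have := (hcn.pow_right (n := 2)).add_mul_left_right (16 * n + 9 * e)
      convert this using 1 <;> first | ring1 | rfl
    have c2 : IsCoprime e (16 * n ^ 2 + 9 * n * e + e ^ 2) := by
      have h16 : IsCoprime e (16 * n ^ 2) := by
        apply IsCoprime.mul_right
        · rw [show (16 : ℤ) = 2 ^ 4 by norm_num]; exact (Int.isCoprime_two_left.mpr heO).symm.pow_right
        · exact hcn.symm.pow_right
      have := h16.add_mul_left_right (9 * n + e)
      convert this using 1 <;> first | ring1 | rfl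
    have hn : 0 < n := by omega
    have hpos : 0 < 16 * n ^ 2 + 9 * n * e + e ^ 2 := by positivity
    obtain ⟨a, ha⟩ := hq_sq_of_coprime hn (hcn.mul_right c1) h'
    obtain ⟨b, hb⟩ := hq_sq_of_coprime he (hcn.symm.mul_right c2) (by rw [← h']; ring)
    obtain ⟨N, hN⟩ := hq_sq_of_coprime hpos (c1.symm.mul_right c2.symm) (by rw [← h']; ring)
    have hbO : Odd b := by rw [hb] at heO; exact (Int.odd_pow' (by norm_num)).mp heO
    rw [ha, hb] at hcn hN
    have hcab : IsCoprime a b := (IsCoprime.pow_iff (by norm_num) (by norm_num)).mp hcn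
    have := hq_typeI hbO hcab.symm (N := N) (by rw [← hN]; ring)
    rw [this] at ha
    omega
  · obtain ⟨W, rfl⟩ : 2 ∣ Z := by
      rw [← Int.pow_dvd_pow_iff two_ne_zero]
      exact ⟨m' * e * (8 * m' ^ 2 + 9 * m' * e + 2 * e ^ 2), by rw [← h]; ring⟩
    have h' : m' * (e * (8 * m' ^ 2 + 9 * m' * e + 2 * e ^ 2)) = W ^ 2 := by linarith
    have c1 : IsCoprime m' (8 * m' ^ 2 + 9 * m' * e + 2 * e ^ 2) := by
      have h2 : IsCoprime m' (2 * e ^ 2) :=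
        (Int.isCoprime_two_left.mpr hO).symm.mul_right hc'.pow_right
      have := h2.add_mul_left_right (8 * m' + 9 * e)
      convert this using 1 <;> first | ring1 | rfl
    have c2 : IsCoprime e (8 * m' ^ 2 + 9 * m' * e + 2 * e ^ 2) := by
      have h16 : IsCoprime e (8 * m' ^ 2) := by
        apply IsCoprime.mul_right
        · rw [show (8 : ℤ) = 2 ^ 3 by norm_num]; exact (Int.isCoprime_two_left.mpr heO).symm.pow_right
        · exact hc'.symm.pow_right
      have := h16.add_mul_left_right (9 * m' + 2 * e)
      convert this using 1 <;> first | ring1 | rfl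
    have hn : 0 < m' := by omega
    have hpos : 0 < 8 * m' ^ 2 + 9 * m' * e + 2 * e ^ 2 := by positivity
    obtain ⟨a, ha⟩ := hq_sq_of_coprime hn (hc'.mul_right c1) h'
    obtain ⟨b, hb⟩ := hq_sq_of_coprime he (hc'.symm.mul_right c2) (by rw [← h']; ring)
    obtain ⟨N, hN⟩ := hq_sq_of_coprime hpos (c1.symm.mul_right c2.symm) (by rw [← h']; ring)
    have hme : m' * e = (a * b) ^ 2 := by rw [ha, hb]; ring
    have habO : Odd (a * b) := by
      have : Odd ((a * b) ^ 2) := by rw [← hme]; exact hO.mul heO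
      exact (Int.odd_pow' (by norm_num)).mp this
    have y1 := hq_odd_sq_mod8 habO
    have y2 := hq_odd_sq_mod8 hO
    rw [mul_assoc 9, hme] at hN
    rcases Int.even_or_odd N with z | z
    · have := hq_even_sq_mod4 z; omega
    · have := hq_odd_sq_mod8 z; omega

theorem hq_cubic_int {m e Z : ℤ} (hm : 0 < m) (he : 0 < e) (hc : IsCoprime m e)
    (h : m * e * (4 * m ^ 2 + 9 * m * e + 4 * e ^ 2) = Z ^ 2) : False := by
  rcases Int.even_or_odd m with hE | hO
  · exact hq_cubic_even hm he hc hE h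
  rcases Int.even_or_odd e with hE | hO2
  · exact hq_cubic_even he hm hc.symm hE (by rw [← h]; ring)
  have h4 : ∀ t : ℤ, Odd t → IsCoprime t 4 := fun t ht => by
    rw [show (4 : ℤ) = 2 ^ 2 by norm_num]; exact (Int.isCoprime_two_left.mpr ht).symm.pow_right
  have c1 : IsCoprime m (4 * m ^ 2 + 9 * m * e + 4 * e ^ 2) := by
    have := ((h4 m hO).mul_right (hc.pow_right (n := 2))).add_mul_left_right (4 * m + 9 * e)
    convert this using 1 <;> first | ring1 | rfl
  have c2 : IsCoprime e (4 * m ^ 2 + 9 * m * e + 4 * e ^ 2) := by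
    have := ((h4 e hO2).mul_right (hc.symm.pow_right (n := 2))).add_mul_left_right (4 * e + 9 * m)
    convert this using 1 <;> first | ring1 | rfl
  have hpos : 0 < 4 * m ^ 2 + 9 * m * e + 4 * e ^ 2 := by positivity
  obtain ⟨a, ha⟩ := hq_sq_of_coprime hm (hc.mul_right c1) (by rw [← h]; ring)
  obtain ⟨b, hb⟩ := hq_sq_of_coprime he (hc.symm.mul_right c2) (by rw [← h]; ring)
  obtain ⟨N, hN⟩ := hq_sq_of_coprime hpos (c1.symm.mul_right c2.symm) (by rw [← h]; ring)
  rw [ha] at hO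
  rw [hb] at hO2
  rw [ha, hb] at hc hN
  exact hq_typeII (N := N) ((Int.odd_pow' (by norm_num)).mp hO) ((Int.odd_pow' (by norm_num)).mp hO2)
    ((IsCoprime.pow_iff (by norm_num) (by norm_num)).mp hc) (by rw [← hN]; ring)

theorem hq_cubic {x w : ℚ} (hx0 : 0 < x) (h : x * (4 * x ^ 2 + 9 * x + 4) = w ^ 2) : False := by
  have hd : (x.den : ℚ) ≠ 0 := by exact_mod_cast x.den_nz
  have hx : x = x.num / x.den := (Rat.num_div_den x).symm
  have hcop : IsCoprime x.num (x.den : ℤ) := by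
    rw [Int.isCoprime_iff_gcd_eq_one]
    exact x.reduced
  have h2 : ((x.num * x.den * (4 * x.num ^ 2 + 9 * x.num * x.den + 4 * x.den ^ 2) : ℤ) : ℚ) = (w * x.den ^ 2) ^ 2 := by
    have h3 : (w * x.den ^ 2) ^ 2 = w ^ 2 * x.den ^ 4 := by ring
    rw [h3, ← h]
    push_cast
    clear h h3 hcop hx0
    generalize (x.den : ℚ) = d at *
    generalize (x.num : ℚ) = n at *
    subst hx
    field_simp
  obtain ⟨N, hN⟩ : ∃ N : ℤ, N ^ 2 = x.num * x.den * (4 * x.num ^ 2 + 9 * x.num * x.den + 4 * x.den ^ 2) := by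
    have : IsSquare ((x.num * x.den * (4 * x.num ^ 2 + 9 * x.num * x.den + 4 * x.den ^ 2) : ℤ) : ℚ) :=
      ⟨_, by rw [h2, sq]⟩
    rw [Rat.isSquare_intCast_iff] at this
    obtain ⟨N, hN⟩ := this
    exact ⟨N, by rw [hN, sq]⟩
  exact hq_cubic_int (Rat.num_pos.mpr hx0) (by exact_mod_cast x.den_pos) hcop hN.symm

theorem hq_delta_one {x u v : ℚ} (h1 : x ^ 2 + 4 = u ^ 2) (h2 : (x - 1) ^ 2 + 4 = v ^ 2) : False := by
  wlog hu : 0 ≤ u generalizing u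
  · exact this (u := -u) (by rw [h1]; ring) (by linarith)
  wlog hv : 0 ≤ v generalizing v
  · exact this (v := -v) (by rw [h2]; ring) (by linarith)
  have hu1 : |x| < u := by
    apply lt_of_pow_lt_pow_left₀ 2 hu
    rw [sq_abs]; linarith
  have hv1 : |x - 1| < v := by
    apply lt_of_pow_lt_pow_left₀ 2 hv
    rw [sq_abs]; linarith
  have hu2 := abs_lt.mp hu1
  have hv2 := abs_lt.mp hv1
  obtain ⟨t, ht⟩ : ∃ t, t = (u + x) / 2 := ⟨_, rfl⟩
  obtain ⟨s, hs⟩ : ∃ s, s = (v + x - 1) / 2 := ⟨_, rfl⟩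
  have ht0 : 0 < t := by linarith
  have hs0 : 0 < s := by linarith
  have e1 : t ^ 2 - x * t = 1 := by rw [ht]; linear_combination -h1 / 4
  have e2 : s ^ 2 - (x - 1) * s = 1 := by rw [hs]; linear_combination -h2 / 4
  have e3 : (t - s) * (t * s + 1) = t * s := by linear_combination s * e1 - t * e2
  apply hq_cubic (x := t * s) (w := (t + s) * (t * s + 1) * 1) (mul_pos ht0 hs0)
  linear_combination (-(t - s) * (t * s + 1) - t * s) * e3

theorem hq_E2 {x w : ℚ} (h : (x ^ 2 - 2 * x + 5) * (x ^ 2 + 4) = w ^ 2) : x = 1 / 2 := by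
  have hd : (x.den : ℚ) ≠ 0 := by exact_mod_cast x.den_nz
  have hx : x = x.num / x.den := (Rat.num_div_den x).symm
  have hcop : IsCoprime x.num (x.den : ℤ) := by
    rw [Int.isCoprime_iff_gcd_eq_one]
    exact x.reduced
  obtain ⟨X, hX⟩ : ∃ X : ℤ, X = x.num := ⟨_, rfl⟩
  obtain ⟨Y, hY⟩ : ∃ Y : ℤ, Y = x.den := ⟨_, rfl⟩
  have hYQ : (x.den : ℚ) = (Y : ℚ) := by rw [hY]; simp
  rw [hYQ] at hd hx
  rw [← hX] at hx hcop
  rw [← hY] at hcop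
  have hY0 : Y ≠ 0 := by exact_mod_cast hd
  have hxe : x * Y = X := by rw [hx]; field_simp
  have h2 : ((((X ^ 2 + 4 * Y ^ 2) * ((X - Y) ^ 2 + 4 * Y ^ 2)) : ℤ) : ℚ) = (w * Y ^ 2) ^ 2 := by
    have h3 : (w * Y ^ 2) ^ 2 = w ^ 2 * Y ^ 4 := by ring
    rw [h3, ← h]
    push_cast
    rw [← hxe]
    ring
  obtain ⟨N, hN⟩ : ∃ N : ℤ, (X ^ 2 + 4 * Y ^ 2) * ((X - Y) ^ 2 + 4 * Y ^ 2) = N ^ 2 := by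
    have : IsSquare ((((X ^ 2 + 4 * Y ^ 2) * ((X - Y) ^ 2 + 4 * Y ^ 2)) : ℤ) : ℚ) :=
      ⟨_, by rw [h2, sq]⟩
    rw [Rat.isSquare_intCast_iff] at this
    obtain ⟨N, hN⟩ := this
    exact ⟨N, by rw [hN, sq]⟩
  obtain ⟨U, V, ⟨k1, k2⟩ | ⟨k1, k2⟩⟩ := hq_sq_or (p := 17) (by norm_num) (by positivity) (by positivity) (by
    intro d d1 d2
    have e1 : d ∣ 17 * Y ^ 3 := by
      have := dvd_sub (d1.mul_left (4 * Y)) ((dvd_sub d1 d2).mul_left (2 * X + Y))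
      convert this using 1 <;> first | ring1 | rfl
    have e2 : IsCoprime d Y := by
      apply IsCoprime.of_isCoprime_of_dvd_left _ d1
      have := (hcop.pow_left (m := 2)).add_mul_left_left (4 * Y)
      convert this using 1 <;> first | ring1 | rfl
    exact (e2.pow_right (n := 3)).dvd_of_dvd_mul_right e1) hN
  · exfalso
    have k1' : ((X : ℚ) ^ 2 + 4 * Y ^ 2) = U ^ 2 := by exact_mod_cast k1
    have k2' : (((X : ℚ) - Y) ^ 2 + 4 * Y ^ 2) = V ^ 2 := by exact_mod_cast k2
    refine hq_delta_one (x := x) (u := U / Y) (v := V / Y) ?_ ?_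
    · rw [div_pow, ← k1', ← hxe]; field_simp
    · rw [div_pow, ← k2', ← hxe]; field_simp
  · by_contra hne
    have hne' : 2 * x - 1 ≠ 0 := fun h => hne (by linarith)
    have k1' : ((X : ℚ) ^ 2 + 4 * Y ^ 2) = 17 * U ^ 2 := by exact_mod_cast k1
    have k2' : (((X : ℚ) - Y) ^ 2 + 4 * Y ^ 2) = 17 * V ^ 2 := by exact_mod_cast k2
    have k1'' : x ^ 2 + 4 = 17 * (U / Y) ^ 2 := by
      rw [div_pow, ← mul_div_assoc, ← k1', ← hxe]; field_simp
    have k2'' : (x - 1) ^ 2 + 4 = 17 * (V / Y) ^ 2 := by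
      rw [div_pow, ← mul_div_assoc, ← k2', ← hxe]; field_simp
    obtain ⟨q, hq⟩ : ∃ q, q = 2 * x - 1 := ⟨_, rfl⟩
    rw [← hq] at hne'
    refine hq_delta_one (x := (x + 8) / q) (u := 17 * (U / Y) / q)
      (v := 17 * (V / Y) / q) ?_ ?_
    · generalize (U : ℚ) / Y = a at *
      field_simp
      linear_combination 17 * k1'' + 4 * (q + 2 * x - 1) * hq
    · generalize (V : ℚ) / Y = a at *
      field_simp
      linear_combination 17 * k2'' + (4 * (q + 2 * x - 1) - (17 - q)) * hq

theorem hq_key1 {t n u v h0 : ℚ} (e0 : h0 = 9 - u ^ 2 - 2 * v + t * (-2 - 2 * u))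
    (e1 : -8 - 2 * u * v + t * h0 - n * (-2 - 2 * u) = 0) (e2 : 20 - v ^ 2 - n * h0 = 0) :
    t = 1 ∨ n = 4 + t / 2 ∨ n = t / 2 - 9 / 2 := by
  by_cases hu : u = -1
  · left
    subst hu
    have h : (8 - 2 * v) * (t - 1) = 0 := by rw [e0] at e1; linear_combination e1
    rcases mul_eq_zero.mp h with h | h
    · exfalso
      have hv : v = 4 := by linarith
      subst hv
      norm_num at e0
      rw [e0] at e2
      norm_num at e2
    · linarith
  · right
    have hu1 : 1 + u ≠ 0 := fun h => hu (by linarith)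
    obtain ⟨y, hy⟩ : ∃ y, y = h0 / (2 * (1 + u)) := ⟨_, rfl⟩
    have hy' : h0 = 2 * (1 + u) * y := by rw [hy]; field_simp
    have hy2 := hq_E2 (x := y) (w := y ^ 2 + u * y + v)
      (by linear_combination y * e1 + e2 - y ^ 2 * e0 + (y ^ 2 - t * y + n) * hy')
    rw [hy2] at hy'
    have hh : h0 = 1 + u := by linarith
    subst hh
    have hsq : (1 / 4 + u / 2 + v - 17 / 4) * (1 / 4 + u / 2 + v + 17 / 4) = 0 := by
      linear_combination -e1 / 2 - e2 + e0 / 4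
    rcases mul_eq_zero.mp hsq with h | h
    · left
      have hv : v = 4 - u / 2 := by linarith
      subst hv
      apply mul_left_cancel₀ hu1
      linear_combination -e2 - e0 / 4
    · right
      have hv : v = -9 / 2 - u / 2 := by linarith
      subst hv
      apply mul_left_cancel₀ hu1
      linear_combination -e2 - e0 / 4

section hqField
variable {K : Type*} [Field K] [CharZero K] [Algebra ℚ K]
set_option linter.unusedSectionVars false

theorem hq_indep {x : K} (hx : ∀ q : ℚ, x ≠ q) {a b : ℚ} (h : (a : K) + b * x = 0) :
    a = 0 ∧ b = 0 := by
  have hb : b = 0 := by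
    by_contra hb
    have hb' : (b : K) ≠ 0 := by exact_mod_cast hb
    apply hx (-a / b)
    push_cast
    field_simp
    linear_combination h
  subst hb
  simp at h
  exact ⟨h, rfl⟩

theorem hq_span (hK : Module.finrank ℚ K = 2) {x : K} (hx : ∀ q : ℚ, x ≠ q) (y : K) :
    ∃ a b : ℚ, y = a + b * x := by
  have hli : LinearIndependent ℚ ![(1 : K), x] := by
    rw [LinearIndependent.pair_iff]
    intro s t h
    rw [Algebra.smul_def, Algebra.smul_def, eq_ratCast, eq_ratCast, mul_one] at h
    exact hq_indep hx h
  haveI : Module.Finite ℚ K := Module.finite_of_finrank_pos (by rw [hK]; norm_num)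
  have htop := hli.span_eq_top_of_card_eq_finrank' (by simp [hK])
  have hy : y ∈ Submodule.span ℚ (Set.range ![(1 : K), x]) := by rw [htop]; trivial
  rw [Matrix.range_cons, Matrix.range_cons, Matrix.range_empty, Set.union_empty,
    Set.singleton_union, Submodule.mem_span_pair] at hy
  obtain ⟨a, b, hab⟩ := hy
  rw [Algebra.smul_def, Algebra.smul_def, eq_ratCast, eq_ratCast, mul_one] at hab
  exact ⟨a, b, hab.symm⟩

theorem hq_key2 (hK : Module.finrank ℚ K = 2) {x w : K} (hx : ∀ q : ℚ, x ≠ q) {t n : ℚ}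
    (hq : x ^ 2 = t * x - n) (h : (x ^ 2 - 2 * x + 5) * (x ^ 2 + 4) = w ^ 2) :
    t = 1 ∨ n = 4 + t / 2 ∨ n = t / 2 - 9 / 2 := by
  obtain ⟨α, β, rfl⟩ := hq_span hK hx w
  obtain ⟨u, hu⟩ : ∃ u, u = β - t := ⟨_, rfl⟩
  obtain ⟨v, hv⟩ : ∃ v, v = α + n := ⟨_, rfl⟩
  obtain ⟨h0, e0⟩ : ∃ h0, h0 = 9 - u ^ 2 - 2 * v + t * (-2 - 2 * u) := ⟨_, rfl⟩
  have := hq_indep hx (a := 20 - v ^ 2 - n * h0)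
    (b := -8 - 2 * u * v + t * h0 - n * (-2 - 2 * u)) (by
      have hw : (α : K) + β * x = x ^ 2 + u * x + v := by
        rw [hu, hv, hq]; push_cast; ring
      rw [hw] at h
      have e0' : (h0 : K) = 9 - u ^ 2 - 2 * v + t * (-2 - 2 * u) := by rw [e0]; push_cast; ring
      push_cast
      linear_combination h - ((-2 - 2 * u) * x + h0) * hq + x ^ 2 * e0')
  exact hq_key1 e0 this.2 this.1

theorem hq_norm (hK : Module.finrank ℚ K = 2) {x D : K} (hx : ∀ q : ℚ, x ≠ q) {t n : ℚ}
    (hq : x ^ 2 = t * x - n) (b c : ℚ) (h : D ^ 2 = x ^ 2 + b * x + c) :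
    ∃ M : ℚ, M ^ 2 = (c - n) ^ 2 + (c - n) * (t + b) * t + n * (t + b) ^ 2 := by
  obtain ⟨α, β, rfl⟩ := hq_span hK hx D
  obtain ⟨h1, h2⟩ := hq_indep hx (a := α ^ 2 - n * β ^ 2 - (c - n)) (b := 2 * α * β + β ^ 2 * t - (t + b)) (by
    push_cast
    linear_combination h + (1 - β ^ 2) * hq)
  refine ⟨α ^ 2 + α * β * t + n * β ^ 2, ?_⟩
  have e1 : c - n = α ^ 2 - n * β ^ 2 := by linarith
  have e2 : t + b = 2 * α * β + β ^ 2 * t := by linarith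
  rw [e1, e2]; ring

theorem hq_nonsq (k : ℕ) (hk : ¬ IsSquare k) (M : ℚ) : M ^ 2 ≠ k := by
  intro h
  apply hk
  rw [← Rat.isSquare_natCast_iff]
  exact ⟨M, by rw [← h, sq]⟩

theorem hq_irrational_case (hK : Module.finrank ℚ K = 2) {x A B D : K} (hx : ∀ q : ℚ, x ≠ q)
    (hA : A ^ 2 = x ^ 2 - 2 * x + 5) (hB : B ^ 2 = x ^ 2 + 2 * x + 5) (hD : D ^ 2 = x ^ 2 + 4) :
    False := by
  have n17 := fun M : ℚ => hq_nonsq 17 (by decide +kernel) M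
  have n85 := fun M : ℚ => hq_nonsq 85 (by decide +kernel) M
  have n34 := fun M : ℚ => hq_nonsq 34 (by decide +kernel) M
  push_cast at n17 n85 n34
  obtain ⟨n', t, hq'⟩ := hq_span hK hx (x ^ 2)
  obtain ⟨n, rfl⟩ : ∃ n, n' = -n := ⟨-n', by simp⟩
  have hq : x ^ 2 = t * x - n := by rw [hq']; push_cast; ring
  have c1 := hq_key2 hK (w := A * D) hx hq (by rw [mul_pow, hA, hD])
  have c2 := hq_key2 hK (x := -x) (w := B * D) (t := -t) (n := n)
    (fun q h => hx (-q) (by push_cast; rw [← h]; ring)) (by rw [neg_sq, hq]; push_cast; ring)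
    (by rw [mul_pow, hB, hD]; ring)
  obtain ⟨M, hM⟩ := hq_norm hK hx hq 0 4 (D := D) (by rw [hD]; push_cast; ring)
  have hM' : M ^ 2 = (n - 4) ^ 2 + 4 * t ^ 2 := by rw [hM]; ring
  clear hM
  have case1 : n = 7 / 2 → t ^ 2 = 1 → False := fun h1 h2 =>
    n17 (2 * M) (by rw [mul_pow, hM', h1, h2]; norm_num)
  have case2 : n = -5 → t ^ 2 = 1 → False := fun h1 h2 =>
    n85 M (by rw [hM', h1, h2]; norm_num)
  have case3 : n = -1 / 4 → t ^ 2 = 289 / 4 → False := fun h1 h2 =>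
    n17 (M * 4 / 17) (by rw [div_pow, mul_pow, hM', h1, h2]; norm_num)
  have case4 : n = 4 → t = 0 → False := fun h1 h2 => by
    obtain ⟨M, hM⟩ := hq_norm hK hx hq (-2) 5 (D := A) (by rw [hA]; push_cast; ring)
    exact n17 M (by rw [hM, h1, h2]; norm_num)
  have case5 : n = -9 / 2 → t = 0 → False := fun h1 h2 => by
    obtain ⟨α, β, hab⟩ := hq_span hK hx D
    rw [h1, h2] at hq
    push_cast at hq
    obtain ⟨h3, h4⟩ := hq_indep hx (a := α ^ 2 + 9 / 2 * β ^ 2 - 17 / 2) (b := 2 * α * β) (by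
      push_cast
      rw [hab] at hD
      linear_combination hD + (1 - β ^ 2) * hq)
    rcases mul_eq_zero.mp h4 with h | h
    · have : α = 0 := by linarith
      subst this
      exact n17 (3 * β) (by linear_combination 2 * h3)
    · subst h
      exact n34 (2 * α) (by linear_combination 4 * h3)
  rcases c1 with c1 | c1 | c1 <;> rcases c2 with c2 | c2 | c2
  · linarith
  · exact case1 (by linarith) (by rw [c1]; norm_num)
  · exact case2 (by linarith) (by rw [c1]; norm_num)
  · exact case1 (by linarith) (by rw [show t = -1 by linarith]; norm_num)
  · exact case4 (by linarith) (by linarith)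
  · exact case3 (by linarith) (by rw [show t = -17 / 2 by linarith]; norm_num)
  · exact case2 (by linarith) (by rw [show t = -1 by linarith]; norm_num)
  · exact case3 (by linarith) (by rw [show t = 17 / 2 by linarith]; norm_num)
  · exact case5 (by linarith) (by linarith)

theorem hq_prod_rat (hK : Module.finrank ℚ K = 2) {A B : K} {a b : ℚ} (hA : A ^ 2 = a)
    (hB : B ^ 2 = b) (hA' : ∀ q : ℚ, A ≠ q) (hB' : ∀ q : ℚ, B ≠ q) : ∃ w : ℚ, a * b = w ^ 2 := by
  obtain ⟨α, β, h⟩ := hq_span hK hA' B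
  obtain ⟨h3, h4⟩ := hq_indep hA' (a := α ^ 2 + β ^ 2 * a - b) (b := 2 * α * β) (by
    push_cast
    rw [h] at hB
    linear_combination hB - β ^ 2 * hA)
  rcases mul_eq_zero.mp h4 with h5 | h5
  · have : α = 0 := by linarith
    subst this
    exact ⟨β * a, by linear_combination -a * h3⟩
  · subst h5
    exact (hB' α (by rw [h]; simp)).elim

theorem hq_rational_case (hK : Module.finrank ℚ K = 2) {x : ℚ} {A B D : K} (hx : x ≠ 0)
    (hA : A ^ 2 = (x : K) ^ 2 - 2 * x + 5) (hB : B ^ 2 = (x : K) ^ 2 + 2 * x + 5)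
    (hD : D ^ 2 = (x : K) ^ 2 + 4) : x ^ 2 = 1 / 4 := by
  have hA' : A ^ 2 = ((x ^ 2 - 2 * x + 5 : ℚ) : K) := by rw [hA]; push_cast; ring
  have hB' : B ^ 2 = ((x ^ 2 + 2 * x + 5 : ℚ) : K) := by rw [hB]; push_cast; ring
  have hD' : D ^ 2 = ((x ^ 2 + 4 : ℚ) : K) := by rw [hD]; push_cast; ring
  have hAB : ¬ ∃ w : ℚ, (x ^ 2 - 2 * x + 5) * (x ^ 2 + 2 * x + 5) = w ^ 2 :=
    fun ⟨w, hw⟩ => hx (hq_E1 hw)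
  have hAD : (∃ w : ℚ, (x ^ 2 - 2 * x + 5) * (x ^ 2 + 4) = w ^ 2) → x ^ 2 = 1 / 4 :=
    fun ⟨w, hw⟩ => by rw [hq_E2 hw]; norm_num
  have hBD : (∃ w : ℚ, (x ^ 2 + 2 * x + 5) * (x ^ 2 + 4) = w ^ 2) → x ^ 2 = 1 / 4 :=
    fun ⟨w, hw⟩ => by
      have := hq_E2 (x := -x) (w := w) (by rw [← hw]; ring)
      rw [show x = -(1 / 2) by linarith]; norm_num
  have rr : ∀ {P Q : K} {a b p q : ℚ}, P ^ 2 = a → Q ^ 2 = b → P = p → Q = q →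
      ∃ w : ℚ, a * b = w ^ 2 := by
    intro P Q a b p q h1 h2 h3 h4
    rw [h3] at h1
    rw [h4] at h2
    norm_cast at h1 h2
    exact ⟨p * q, by rw [← h1, ← h2]; ring⟩
  by_cases pA : ∃ q : ℚ, A = q <;> by_cases pB : ∃ q : ℚ, B = q <;> by_cases pD : ∃ q : ℚ, D = q
  · exact (hAB (rr hA' hB' pA.choose_spec pB.choose_spec)).elim
  · exact (hAB (rr hA' hB' pA.choose_spec pB.choose_spec)).elim
  · exact hAD (rr hA' hD' pA.choose_spec pD.choose_spec)
  · push Not at pB pD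
    exact hBD (hq_prod_rat hK hB' hD' pB pD)
  · exact hBD (rr hB' hD' pB.choose_spec pD.choose_spec)
  · push Not at pA pD
    exact hAD (hq_prod_rat hK hA' hD' pA pD)
  · push Not at pA pB
    exact (hAB (hq_prod_rat hK hA' hB' pA pB)).elim
  · push Not at pA pB
    exact (hAB (hq_prod_rat hK hA' hB' pA pB)).elim

theorem hq_main (hK : Module.finrank ℚ K = 2) {x A B D : K} (hx : x ≠ 0)
    (hA : A ^ 2 = x ^ 2 - 2 * x + 5) (hB : B ^ 2 = x ^ 2 + 2 * x + 5) (hD : D ^ 2 = x ^ 2 + 4) :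
    x ^ 2 = 1 / 4 := by
  by_cases h : ∃ q : ℚ, x = q
  · obtain ⟨q, rfl⟩ := h
    have := hq_rational_case hK (x := q) (by exact_mod_cast hx) hA hB hD
    have h2 : ((q ^ 2 : ℚ) : K) = ((1 / 4 : ℚ) : K) := by rw [this]
    push_cast at h2
    exact h2
  · push Not at h
    exact (hq_irrational_case hK h hA hB hD).elim

theorem hq_type {c r : K} (hr : IsTypeMN c 2 2 r) :
    ∃ q : K, (fc c)^[2] r = q ∧ c = -1 - q - q ^ 2 ∧ 2 * q + 1 ≠ 0 ∧ r ^ 2 = q ^ 2 + 2 * q + 2 := by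
  obtain ⟨⟨h1, h2⟩, h3⟩ := hr
  refine ⟨(fc c)^[2] r, rfl, ?_⟩
  have h2' := h2 1 le_rfl (by norm_num)
  have hfr : (fc c)^[2] r = (r ^ 2 + c) ^ 2 + c := rfl
  obtain ⟨y, hy⟩ : ∃ y, y = r ^ 2 + c := ⟨_, rfl⟩
  have h3' : ¬ IsPeriodicPt c y := by rw [hy]; exact h3
  rw [← hy] at hfr
  obtain ⟨q, hq⟩ : ∃ q, q = (fc c)^[2] r := ⟨_, rfl⟩
  rw [← hq] at h1 h2' hfr ⊢
  change (q ^ 2 + c) ^ 2 + c = q at h1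
  change q ^ 2 + c ≠ q at h2'
  have hc : c = -1 - q - q ^ 2 := by
    have : (q ^ 2 + c - q) * (q ^ 2 + c + q + 1) = 0 := by linear_combination h1
    rcases mul_eq_zero.mp this with h | h
    · exact (h2' (by linear_combination h)).elim
    · linear_combination h
  have hy2 : (y - (q ^ 2 + c)) * (y + (q ^ 2 + c)) = 0 := by linear_combination -h1 - hfr
  have hy3 : y = -(q ^ 2 + c) := by
    rcases mul_eq_zero.mp hy2 with h | h
    · exfalso
      apply h3'
      refine ⟨2, by norm_num, ?_⟩
      change (y ^ 2 + c) ^ 2 + c = y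
      rw [← hfr]; linear_combination -h
    · linear_combination h
  refine ⟨hc, ?_, ?_⟩
  · intro h
    apply h2'
    rw [hc]; linear_combination -h
  · rw [hy3] at hy
    linear_combination -hy - 2 * hc
end hqField

/-- If `K` is a quadratic field, `c ∈ K`, `f_c` has a `K`-rational fixed point `p` and
`K`-rational points `r, s` of type `2₂` with `f_c²(r) ≠ f_c²(s)` (as when `G(f_c, K)` contains
a graph of type 12(2,1,1)a), then `c = -13/16` and `K = ℚ(√17)`. -/
theorem graph_12_2_1_1a_classification (K : IntermediateField ℚ ℂ)
    (hK : Module.finrank ℚ K = 2) (c p r s : K)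
    (hp : fc c p = p)
    (hr : IsTypeMN c 2 2 r) (hs : IsTypeMN c 2 2 s)
    (hne : (fc c)^[2] r ≠ (fc c)^[2] s) :
    c = -13 / 16 ∧ ∃ z : ℂ, z ^ 2 = 17 ∧ K = ℚ⟮z⟯ := by
  obtain ⟨q, q1, q2, q3, q4⟩ := hq_type hr
  obtain ⟨v, v1, v2, v3, v4⟩ := hq_type hs
  rw [q1, v1] at hne
  have hv : v = -1 - q := by
    have : (q - v) * (q + v + 1) = 0 := by linear_combination q2 - v2
    rcases mul_eq_zero.mp this with h | h
    · exact (hne (by linear_combination h)).elim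
    · linear_combination h
  change p ^ 2 + c = p at hp
  have hx := hq_main hK (x := 2 * q + 1) (A := 2 * s) (B := 2 * r) (D := 2 * p - 1) q3
    (by rw [mul_pow, v4, hv]; ring) (by rw [mul_pow, q4]; ring) (by linear_combination 4 * hp - 4 * q2)
  have hc : c = -13 / 16 := by rw [q2]; linear_combination -hx / 4
  refine ⟨hc, ((2 * (2 * p - 1) : K) : ℂ), ?_, ?_⟩
  · have : (2 * (2 * p - 1) : K) ^ 2 = 17 := by rw [hc] at hp; linear_combination 16 * hp
    rw [← IntermediateField.coe_pow, this]; rfl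
  · have hz : (2 * (2 * p - 1) : K) ^ 2 = 17 := by rw [hc] at hp; linear_combination 16 * hp
    generalize (2 * (2 * p - 1) : K) = z at hz
    have hz' : ∀ a : ℚ, z ≠ a := by
      rintro a rfl
      apply hq_nonsq 17 (by decide +kernel) a
      push_cast
      exact_mod_cast hz
    apply le_antisymm
    · intro y hy
      obtain ⟨a, b, hab⟩ := hq_span hK hz' ⟨y, hy⟩
      have : y = (a : ℂ) + b * (z : ℂ) := by
        have := congrArg (fun w : K => (w : ℂ)) hab
        simpa using this
      rw [this]
      have ha : ∀ a : ℚ, (a : ℂ) ∈ ℚ⟮(z : ℂ)⟯ := fun a => by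
        have := (ℚ⟮(z : ℂ)⟯).algebraMap_mem a
        simpa using this
      exact add_mem (ha a) (mul_mem (ha b) (mem_adjoin_simple_self ℚ _))
    · rw [adjoin_simple_le_iff]; exact z.2
end
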